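/- (Convergence of the Schwarz iteration) Suppose assumptions (A1)–(A5) hold. Let θ^l be the classical solution of the decoupling PDE system on (0,T)×𝒪_l with lateral boundary data g and terminal data g, and let θ^l_{p,q} be the Schwarz iterates. Then lim_{q→∞} sup_{p ∈ {1,…,I}} ‖θ^l_{p,q} − θ^l‖_{(L^∞((0,T)×(−l,l)^{n−1}×(a_p,b_p)))ᵐ} = 0. -/

import Mathlib

noncomputable section

open Set Matrix

attribute [local instance] Matrix.normedAddCommGroup Matrix.normedSpace

/-- `ES n` is the Euclidean space `ℝⁿ`. -/
abbrev ES (n : ℕ) : Type := EuclideanSpace ℝ (Fin n)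

/-- Partial derivative of `f : ℝⁿ → ℝ` in the `i`-th coordinate direction. -/
def pd {n : ℕ} (i : Fin n) (f : ES n → ℝ) (x : ES n) : ℝ :=
  fderiv ℝ f x (EuclideanSpace.single i 1)

/-- Second-order partial derivative `∂²f/∂x_i∂x_j`. -/
def pd2 {n : ℕ} (i j : Fin n) (f : ES n → ℝ) (x : ES n) : ℝ :=
  pd i (pd j f) x

/-- `f` is a `C¹` function with bounded derivative. -/
def C1Bdd {E F : Type*} [NormedAddCommGroup E] [NormedSpace ℝ E]
    [NormedAddCommGroup F] [NormedSpace ℝ F] (f : E → F) : Prop :=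
  ContDiff ℝ 1 f ∧ ∃ K : ℝ, ∀ x, ‖fderiv ℝ f x‖ ≤ K

/-- `g` is bounded in `C^{2+δ}(ℝⁿ)`. -/
def BddC2Holder {n m : ℕ} (δ : ℝ) (g : ES n → ES m) : Prop :=
  ContDiff ℝ 2 g ∧ ∃ K : ℝ,
    (∀ x, ‖g x‖ ≤ K ∧ ‖fderiv ℝ g x‖ ≤ K ∧ ‖fderiv ℝ (fderiv ℝ g) x‖ ≤ K) ∧
    ∀ x y, ‖fderiv ℝ (fderiv ℝ g) x - fderiv ℝ (fderiv ℝ g) y‖ ≤ K * ‖x - y‖ ^ δ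

/-- `θ` is `C¹` in time and `C²` in space at the point `(t,x)`. -/
def RegAt {n m : ℕ} (θ : ℝ → ES n → ES m) (t : ℝ) (x : ES n) : Prop :=
  ∀ k : Fin m,
    DifferentiableAt ℝ (fun s => θ s x k) t ∧
    DifferentiableAt ℝ (fun x' => θ t x' k) x ∧
    ∀ j : Fin n, DifferentiableAt ℝ (pd j (fun x' => θ t x' k)) x

/-- `θ` satisfies, at the point `(t,x)`, the quasilinear parabolic system
`∂θ/∂t + Σ aᵢⱼ(t,x,θ) ∂²θ/∂xᵢ∂xⱼ + ⟨∇θ, b(t,x,θ)⟩ + b̂(t,x,θ) = 0` (componentwise). -/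
def SatPDEAt {n m : ℕ} (a : ℝ → ES n → ES m → Matrix (Fin n) (Fin n) ℝ)
    (b : ℝ → ES n → ES m → ES n) (bh : ℝ → ES n → ES m → ES m)
    (θ : ℝ → ES n → ES m) (t : ℝ) (x : ES n) : Prop :=
  ∀ k : Fin m,
    deriv (fun s => θ s x k) t
      + ∑ i, ∑ j, a t x (θ t x) i j * pd2 i j (fun x' => θ t x' k) x
      + ∑ i, pd i (fun x' => θ t x' k) x * (b t x (θ t x)) i
      + bh t x (θ t x) k = 0

/-- `θ` is a classical solution of the quasilinear parabolic system on `(0,T) × Q`: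
it is continuous on `[0,T] × Q̄` and pointwise regular and satisfies the PDE inside. -/
def IsSolOn {n m : ℕ} (T : ℝ) (a : ℝ → ES n → ES m → Matrix (Fin n) (Fin n) ℝ)
    (b : ℝ → ES n → ES m → ES n) (bh : ℝ → ES n → ES m → ES m)
    (Q : Set (ES n)) (θ : ℝ → ES n → ES m) : Prop :=
  ContinuousOn (fun p : ℝ × ES n => θ p.1 p.2) (Icc 0 T ×ˢ closure Q) ∧
  ∀ t ∈ Ioo 0 T, ∀ x ∈ Q, RegAt θ t x ∧ SatPDEAt a b bh θ t x

/-- `θ`, `∂θ/∂t`, `∇θ` and `Δθ` are all bounded on `(0,T) × Q`. -/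
def DerivBdd {n m : ℕ} (T : ℝ) (Q : Set (ES n)) (θ : ℝ → ES n → ES m) : Prop :=
  ∃ K : ℝ, ∀ t ∈ Ioo 0 T, ∀ x ∈ Q, ∀ k : Fin m,
    ‖θ t x‖ ≤ K ∧ |deriv (fun s => θ s x k) t| ≤ K ∧
    (∀ i, |pd i (fun x' => θ t x' k) x| ≤ K) ∧
    |∑ i, pd2 i i (fun x' => θ t x' k) x| ≤ K

/-- The coefficient matrix `a = ½ σ σᵀ`. -/
def halfSigmaSigmaT {n m d : ℕ} (σ : ℝ → ES n → ES m → Matrix (Fin n) (Fin d) ℝ) :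
    ℝ → ES n → ES m → Matrix (Fin n) (Fin n) ℝ :=
  fun t x y => (2 : ℝ)⁻¹ • (σ t x y * (σ t x y)ᵀ)

/-- Assumption (A1): the coefficients are `C¹` with bounded partial derivatives and
`g` is bounded in `C^{2+δ}`. -/
def AssumptionA1 {n m d : ℕ} (b : ℝ → ES n → ES m → ES n)
    (σ : ℝ → ES n → ES m → Matrix (Fin n) (Fin d) ℝ)
    (bh : ℝ → ES n → ES m → ES m)
    (σh : ℝ → ES n → ES m → Matrix (Fin m) (Fin d) ℝ → Matrix (Fin m) (Fin d) ℝ)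
    (g : ES n → ES m) (δ : ℝ) : Prop :=
  C1Bdd (fun p : ℝ × ES n × ES m => b p.1 p.2.1 p.2.2) ∧
  C1Bdd (fun p : ℝ × ES n × ES m => bh p.1 p.2.1 p.2.2) ∧
  C1Bdd (fun p : ℝ × ES n × ES m => σ p.1 p.2.1 p.2.2) ∧
  C1Bdd (fun p : (ℝ × ES n × ES m) × Matrix (Fin m) (Fin d) ℝ =>
    σh p.1.1 p.1.2.1 p.1.2.2 p.2) ∧
  C1Bdd g ∧ δ ∈ Ioo (0 : ℝ) 1 ∧ BddC2Holder δ g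

/-- Assumption (A2): `σ` is bounded and `σσᵀ ≥ ν(|y|) I` uniformly. -/
def AssumptionA2 {n m d : ℕ} (T : ℝ) (σ : ℝ → ES n → ES m → Matrix (Fin n) (Fin d) ℝ)
    (ν : ℝ → ℝ) (C : ℝ) : Prop :=
  0 < C ∧ Continuous ν ∧ (∀ r, 0 < ν r) ∧
  ∀ t ∈ Icc (0 : ℝ) T, ∀ (x : ES n) (y : ES m),
    ‖σ t x y‖ ≤ C ∧
    (σ t x y * (σ t x y)ᵀ - ν ‖y‖ • (1 : Matrix (Fin n) (Fin n) ℝ)).PosSemidef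

/-- Assumption (A3): kernel bound, bijectivity of `z ↦ σ̂(t,x,y,z)` with jointly
continuous inverse `σinv` satisfying an `α`-Hölder estimate. -/
def AssumptionA3 {n m d : ℕ} (T : ℝ)
    (σh σinv : ℝ → ES n → ES m → Matrix (Fin m) (Fin d) ℝ → Matrix (Fin m) (Fin d) ℝ)
    (κ lam : ℝ → ℝ) (α : ℝ) : Prop :=
  Continuous κ ∧ (∀ r, 0 < κ r) ∧
  (∀ t ∈ Icc (0 : ℝ) T, ∀ (x : ES n) (y : ES m) (z : Matrix (Fin m) (Fin d) ℝ),
    σh t x y z = 0 → ‖z‖ ≤ κ ‖y‖) ∧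
  (∀ (t : ℝ) (x : ES n) (y : ES m), Function.Bijective (σh t x y)) ∧
  (∀ (t : ℝ) (x : ES n) (y : ES m) (z : Matrix (Fin m) (Fin d) ℝ),
    σinv t x y (σh t x y z) = z) ∧
  (∀ (t : ℝ) (x : ES n) (y : ES m) (ζ : Matrix (Fin m) (Fin d) ℝ),
    σh t x y (σinv t x y ζ) = ζ) ∧
  Continuous (fun p : ℝ × ES n × ES m × Matrix (Fin m) (Fin d) ℝ =>
    σinv p.1 p.2.1 p.2.2.1 p.2.2.2) ∧
  Continuous lam ∧ (∀ r, 0 ≤ lam r) ∧ 1 ≤ α ∧ α < 2 ∧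
  ∀ t ∈ Icc (0 : ℝ) T, ∀ (x : ES n) (y : ES m) (ζ ζ' : Matrix (Fin m) (Fin d) ℝ),
    ‖σinv t x y ζ - σinv t x y ζ'‖ ≤ lam ‖y‖ * ‖ζ - ζ'‖ ^ α

/-- Assumption (A4): `|b(t,x,y)| ≤ η(|y|)` and `|b̂(t,x,0)| ≤ C`. -/
def AssumptionA4 {n m : ℕ} (T : ℝ) (b : ℝ → ES n → ES m → ES n)
    (bh : ℝ → ES n → ES m → ES m) (η : ℝ → ℝ) (C : ℝ) : Prop :=
  (∀ r, 0 < η r) ∧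
  (∀ t ∈ Icc (0 : ℝ) T, ∀ (x : ES n) (y : ES m), ‖b t x y‖ ≤ η ‖y‖) ∧
  ∀ t ∈ Icc (0 : ℝ) T, ∀ x : ES n, ‖bh t x 0‖ ≤ C

/-- Assumption (A5): each component `b̂ᵏ` vanishes when `y_k = 0` and is
decreasing in `y_k`. -/
def AssumptionA5 {n m : ℕ} (T : ℝ) (bh : ℝ → ES n → ES m → ES m) : Prop :=
  ∀ k : Fin m,
    (∀ t ∈ Icc (0 : ℝ) T, ∀ (x : ES n) (y : ES m), y k = 0 → bh t x y k = 0) ∧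
    ∀ t ∈ Icc (0 : ℝ) T, ∀ (x : ES n) (y y' : ES m),
      (∀ j, j ≠ k → y j = y' j) → y k ≤ y' k → bh t x y' k ≤ bh t x y k

/-- The open cube `𝒪_l = (-l,l)^{n+1}`. -/
def OpenCube {n : ℕ} (l : ℝ) : Set (ES (n + 1)) :=
  {x | ∀ i : Fin (n + 1), x i ∈ Ioo (-l) l}

/-- The subdomain `Ω_p = (-l,l)ⁿ × (ap, bp)` (split in the last coordinate). -/
def Subdom {n : ℕ} (l ap bp : ℝ) : Set (ES (n + 1)) :=
  {x | (∀ i : Fin (n + 1), i ≠ Fin.last n → x i ∈ Ioo (-l) l) ∧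
       x (Fin.last n) ∈ Ioo ap bp}

/-- The closed face `[-l,l]ⁿ × {c}` (at height `c` in the last coordinate). -/
def SideFace {n : ℕ} (l c : ℝ) : Set (ES (n + 1)) :=
  {x | (∀ i : Fin (n + 1), i ≠ Fin.last n → x i ∈ Icc (-l) l) ∧
       x (Fin.last n) = c}

/-- The overlapping decomposition
`-l = a₁ < a₂ < b₁ < a₃ < b₂ < ⋯ < a_I < b_{I-1} < b_I = l` of `(-l,l)`. -/
def SchwarzPartition (I : ℕ) (l : ℝ) (aa bb : ℕ → ℝ) : Prop :=
  1 ≤ I ∧ 0 < l ∧ aa 1 = -l ∧ bb I = l ∧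
  (∀ p, 1 ≤ p → p < I → aa p < aa (p + 1)) ∧
  (∀ p, 1 ≤ p → p < I → aa (p + 1) < bb p) ∧
  (∀ p, 1 ≤ p → p < I → bb p < bb (p + 1)) ∧
  (∀ p, 1 ≤ p → p + 2 ≤ I → bb p < aa (p + 2))

/-- `Θ p q` is the family of Schwarz waveform-relaxation iterates: `Θ p 0` is the
initial guess `θ₀` on `Ω̄_p`, and for `q ≥ 1`, `Θ p q` is a classical solution (with
bounded derivatives) of the quasilinear system on `(0,T) × Ω_p` whose data on the
interface `x_n = a_p` (resp. `x_n = b_p`) is `Θ (p-1) (q-1)` (resp. `Θ (p+1) (q-1)`),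
taken as `g` for the extreme subdomains, with data `g` on the remaining lateral
boundary of `𝒪_l`, and terminal data `g`. -/
def SchwarzIterates {n m : ℕ} (T l : ℝ) (I : ℕ) (aa bb : ℕ → ℝ)
    (a : ℝ → ES (n + 1) → ES m → Matrix (Fin (n + 1)) (Fin (n + 1)) ℝ)
    (b : ℝ → ES (n + 1) → ES m → ES (n + 1))
    (bh : ℝ → ES (n + 1) → ES m → ES m)
    (g : ES (n + 1) → ES m) (θ0 : ES (n + 1) → ES m)
    (Θ : ℕ → ℕ → ℝ → ES (n + 1) → ES m) : Prop :=
  (∀ p ∈ Icc 1 I, ∀ t ∈ Icc (0 : ℝ) T,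
    ∀ x ∈ closure (Subdom l (aa p) (bb p)), Θ p 0 t x = θ0 x) ∧
  ∀ p ∈ Icc 1 I, ∀ q : ℕ, 1 ≤ q →
    IsSolOn T a b bh (Subdom l (aa p) (bb p)) (Θ p q) ∧
    DerivBdd T (Subdom l (aa p) (bb p)) (Θ p q) ∧
    (∀ t ∈ Icc (0 : ℝ) T, ∀ x ∈ closure (Subdom l (aa p) (bb p)),
      (x (Fin.last n) = aa p →
        (if p = 1 then Θ p q t x = g x else Θ p q t x = Θ (p - 1) (q - 1) t x)) ∧
      (x (Fin.last n) = bb p →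
        (if p = I then Θ p q t x = g x else Θ p q t x = Θ (p + 1) (q - 1) t x)) ∧
      ((∃ i : Fin (n + 1), i ≠ Fin.last n ∧ (x i = l ∨ x i = -l)) →
        Θ p q t x = g x)) ∧
    ∀ x ∈ closure (Subdom l (aa p) (bb p)), Θ p q T x = g x

/-- `θl` is a classical solution of the decoupling PDE on `(0,T) × 𝒪_l` with lateral
boundary data `g` and terminal data `g`, with bounded derivatives. -/
def IsCubeSolution {n m : ℕ} (T l : ℝ)
    (a : ℝ → ES (n + 1) → ES m → Matrix (Fin (n + 1)) (Fin (n + 1)) ℝ)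
    (b : ℝ → ES (n + 1) → ES m → ES (n + 1))
    (bh : ℝ → ES (n + 1) → ES m → ES m)
    (g : ES (n + 1) → ES m) (θl : ℝ → ES (n + 1) → ES m) : Prop :=
  IsSolOn T a b bh (OpenCube l) θl ∧
  (∀ t ∈ Icc (0 : ℝ) T, ∀ x ∈ frontier (OpenCube (n := n) l), θl t x = g x) ∧
  (∀ x ∈ closure (OpenCube (n := n) l), θl T x = g x) ∧
  DerivBdd T (OpenCube l) θl


/-! ### Second order jets of functions of one real variable at `0` -/

/-- `h` is differentiable near `0` and its derivative is differentiable at `0`. -/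
def J2 (h : ℝ → ℝ) (h1 h2 : ℝ) : Prop :=
  ∃ h' : ℝ → ℝ, (∀ᶠ s in nhds (0 : ℝ), HasDerivAt h (h' s) s) ∧ h' 0 = h1 ∧ HasDerivAt h' h2 0

lemma J2.hasDerivAt {h : ℝ → ℝ} {h1 h2 : ℝ} (H : J2 h h1 h2) : HasDerivAt h h1 0 := by
  obtain ⟨h', e, r, _⟩ := H
  rw [← r]
  exact e.self_of_nhds

lemma J2.add {f g : ℝ → ℝ} {f1 f2 g1 g2 : ℝ} (F : J2 f f1 f2) (G : J2 g g1 g2) :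
    J2 (fun s => f s + g s) (f1 + g1) (f2 + g2) := by
  obtain ⟨f', ef, rf, df⟩ := F
  obtain ⟨g', eg, rg, dg⟩ := G
  refine ⟨fun s => f' s + g' s, ?_, by simp [rf, rg], df.add dg⟩
  filter_upwards [ef, eg] with s a b using a.add b

lemma J2.sub {f g : ℝ → ℝ} {f1 f2 g1 g2 : ℝ} (F : J2 f f1 f2) (G : J2 g g1 g2) :
    J2 (fun s => f s - g s) (f1 - g1) (f2 - g2) := by
  obtain ⟨f', ef, rf, df⟩ := F
  obtain ⟨g', eg, rg, dg⟩ := G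
  refine ⟨fun s => f' s - g' s, ?_, by simp [rf, rg], df.sub dg⟩
  filter_upwards [ef, eg] with s a b using a.sub b

lemma J2.const_mul {f : ℝ → ℝ} {f1 f2 : ℝ} (c : ℝ) (F : J2 f f1 f2) :
    J2 (fun s => c * f s) (c * f1) (c * f2) := by
  obtain ⟨f', ef, rf, df⟩ := F
  refine ⟨fun s => c * f' s, ?_, by simp [rf], df.const_mul c⟩
  filter_upwards [ef] with s a using a.const_mul c

lemma J2.const (c : ℝ) : J2 (fun _ => c) 0 0 :=
  ⟨fun _ => 0, Filter.Eventually.of_forall fun s => hasDerivAt_const s c, rfl, hasDerivAt_const _ _⟩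

lemma J2.sum {ι : Type*} (S : Finset ι) {f : ι → ℝ → ℝ} {f1 f2 : ι → ℝ}
    (F : ∀ i, J2 (f i) (f1 i) (f2 i)) :
    J2 (fun s => ∑ i ∈ S, f i s) (∑ i ∈ S, f1 i) (∑ i ∈ S, f2 i) := by
  classical
  induction S using Finset.induction_on with
  | empty => simpa using J2.const 0
  | insert a S ha ih =>
    simp only [Finset.sum_insert ha]
    exact (F a).add ih

lemma J2.sq {f : ℝ → ℝ} {f1 f2 : ℝ} (F : J2 f f1 f2) :
    J2 (fun s => f s ^ 2) (2 * f 0 * f1) (2 * f1 ^ 2 + 2 * f 0 * f2) := by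
  have h0 := F.hasDerivAt
  obtain ⟨f', ef, rf, df⟩ := F
  refine ⟨fun s => 2 * f s * f' s, ?_, by simp [rf], ?_⟩
  · filter_upwards [ef] with s a
    have := a.fun_pow 2
    simpa using this
  · have := (h0.const_mul 2).mul df
    refine this.congr_deriv ?_
    rw [rf]; ring

lemma J2.affine (p q : ℝ) : J2 (fun s => p + s * q) q 0 := by
  refine ⟨fun _ => q, Filter.Eventually.of_forall fun s => ?_, rfl, hasDerivAt_const _ _⟩
  simpa using ((hasDerivAt_id s).mul_const q).const_add p

lemma J2.exp (p q : ℝ) :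
    J2 (fun s => Real.exp (p + s * q)) (q * Real.exp p) (q ^ 2 * Real.exp p) := by
  have A : ∀ s : ℝ, HasDerivAt (fun s => Real.exp (p + s * q)) (Real.exp (p + s * q) * q) s := by
    intro s
    have : HasDerivAt (fun s : ℝ => p + s * q) q s := by
      simpa using ((hasDerivAt_id s).mul_const q).const_add p
    exact this.exp
  refine ⟨fun s => Real.exp (p + s * q) * q, Filter.Eventually.of_forall A, by simp [mul_comm], ?_⟩
  refine ((A 0).mul_const q).congr_deriv ?_
  simp; ring

lemma J2.nonpos {f : ℝ → ℝ} {f1 f2 : ℝ} (F : J2 f f1 f2) (hm : IsLocalMax f 0) : f2 ≤ 0 := by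
  have h0 := F.hasDerivAt
  have z : f1 = 0 := hm.hasDerivAt_eq_zero h0
  obtain ⟨f', ef, rf, df⟩ := F
  by_contra hpos
  push Not at hpos
  have e1 : deriv f =ᶠ[nhds 0] f' := by
    filter_upwards [ef] with s a using a.deriv
  have e2 : deriv (deriv f) 0 = f2 := by
    rw [e1.deriv_eq]; exact df.deriv
  have hmin : IsLocalMin f 0 :=
    isLocalMin_of_deriv_deriv_pos (by rw [e2]; exact hpos) (by rw [h0.deriv, z]) h0.continuousAt
  have hc : f =ᶠ[nhds 0] fun _ => f 0 := by
    filter_upwards [hm, hmin] with s a b using le_antisymm a b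
  have e3 : deriv f =ᶠ[nhds 0] fun _ => (0 : ℝ) := by
    have := hc.eventuallyEq_nhds
    filter_upwards [this] with s hs
    rw [hs.deriv_eq]; simp
  rw [e3.deriv_eq] at e2
  simp at e2
  linarith

lemma deriv_nonpos_of_right_max {f : ℝ → ℝ} {f' t T : ℝ} (h : HasDerivAt f f' t) (ht : t < T)
    (hm : ∀ s ∈ Set.Icc t T, f s ≤ f t) : f' ≤ 0 := by
  have hw : HasDerivWithinAt f f' (Set.Ioi t) t := h.hasDerivWithinAt
  have := hasDerivWithinAt_iff_tendsto_slope' (self_notMem_Ioi) |>.1 hw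
  refine le_of_tendsto this ?_
  filter_upwards [Ioo_mem_nhdsGT ht] with s hs
  rw [slope_def_field]
  apply div_nonpos_of_nonpos_of_nonneg
  · linarith [hm s ⟨hs.1.le, hs.2.le⟩]
  · linarith [hs.1]

lemma es_eq_sum {n : ℕ} (ξ : ES n) : ξ = ∑ i, ξ i • (EuclideanSpace.single i 1 : ES n) := by
  ext j
  simp [Finset.sum_apply, Pi.single_apply]

lemma fderiv_eq_pd {n : ℕ} (f : ES n → ℝ) (x ξ : ES n) :
    fderiv ℝ f x ξ = ∑ i, ξ i * pd i f x := by
  conv_lhs => rw [es_eq_sum ξ]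
  simp [pd]

lemma line_hasDerivAt {n : ℕ} {f : ES n → ℝ} {x ξ : ES n} {s : ℝ}
    (h : DifferentiableAt ℝ f (x + s • ξ)) :
    HasDerivAt (fun s : ℝ => f (x + s • ξ)) (∑ i, ξ i * pd i f (x + s • ξ)) s := by
  rw [← fderiv_eq_pd]
  have hl : HasDerivAt (fun s : ℝ => x + s • ξ) ξ s := by
    simpa using ((hasDerivAt_id s).smul_const ξ).const_add x
  exact h.hasFDerivAt.comp_hasDerivAt s hl

lemma line_tendsto {n : ℕ} (x ξ : ES n) :
    Filter.Tendsto (fun s : ℝ => x + s • ξ) (nhds 0) (nhds x) := by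
  have : Continuous (fun s : ℝ => x + s • ξ) := by fun_prop
  simpa using this.tendsto 0

lemma J2.line {n : ℕ} {f : ES n → ℝ} {x ξ : ES n} {Q : Set (ES n)} (hQ : IsOpen Q) (hx : x ∈ Q)
    (hf : ∀ z ∈ Q, DifferentiableAt ℝ f z) (hf2 : ∀ j, DifferentiableAt ℝ (pd j f) x) :
    J2 (fun s => f (x + s • ξ)) (∑ i, ξ i * pd i f x)
      (∑ i, ∑ j, ξ i * ξ j * pd2 i j f x) := by
  refine ⟨fun s => ∑ j, ξ j * pd j f (x + s • ξ), ?_, by simp, ?_⟩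
  · filter_upwards [(line_tendsto x ξ).eventually (hQ.mem_nhds hx)] with s hs
    exact line_hasDerivAt (hf _ hs)
  · have : HasDerivAt (fun s : ℝ => ∑ j, ξ j * pd j f (x + s • ξ))
        (∑ j, ξ j * ∑ i, ξ i * pd i (pd j f) (x + (0 : ℝ) • ξ)) 0 := by
      apply HasDerivAt.fun_sum
      intro j _
      apply HasDerivAt.const_mul
      apply line_hasDerivAt
      simpa using hf2 j
    refine this.congr_deriv ?_
    rw [Finset.sum_comm]
    apply Finset.sum_congr rfl; intro j _
    rw [Finset.mul_sum]
    apply Finset.sum_congr rfl; intro i _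
    simp [pd2]; ring

/-- jets of the coordinate functions of a classical solution -/
lemma sol_jets {n m d : ℕ} {T : ℝ} (σ : ℝ → ES n → ES m → Matrix (Fin n) (Fin d) ℝ)
    (b : ℝ → ES n → ES m → ES n) (bh : ℝ → ES n → ES m → ES m)
    {Q : Set (ES n)} (hQ : IsOpen Q) {θ : ℝ → ES n → ES m}
    (h : ∀ t ∈ Ioo 0 T, ∀ x ∈ Q, RegAt θ t x ∧ SatPDEAt (halfSigmaSigmaT σ) b bh θ t x)
    {t : ℝ} (ht : t ∈ Ioo 0 T) {x : ES n} (hx : x ∈ Q) :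
    ∃ (ut D1 E1 : Fin m → ℝ) (e D2 : Fin d → Fin m → ℝ),
      (∀ k, HasDerivAt (fun s => θ s x k) (ut k) t) ∧
      (∀ k, J2 (fun s => θ t (x + s • b t x (θ t x)) k) (D1 k) (E1 k)) ∧
      (∀ c k, J2 (fun s => θ t (x + s • (WithLp.toLp 2 fun i => σ t x (θ t x) i c : ES n)) k)
        (e c k) (D2 c k)) ∧
      ∀ k, ut k + 2⁻¹ * ∑ c, D2 c k + D1 k + bh t x (θ t x) k = 0 := by
  have hd : ∀ k, ∀ z ∈ Q, DifferentiableAt ℝ (fun x' => θ t x' k) z := fun k z hz =>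
    ((h t ht z hz).1 k).2.1
  have hd2 := fun k => ((h t ht x hx).1 k).2.2
  refine ⟨_, _, _, _, _, fun k => ((h t ht x hx).1 k).1.hasDerivAt,
    fun k => J2.line hQ hx (hd k) (hd2 k),
    fun c k => J2.line hQ hx (hd k) (hd2 k), ?_⟩
  intro k
  have P := (h t ht x hx).2 k
  rw [← P]
  congr 1
  congr 1
  · congr 1
    simp only [halfSigmaSigmaT, Matrix.smul_apply, Matrix.mul_apply, Matrix.transpose_apply,
      smul_eq_mul]
    rw [Finset.sum_comm, Finset.mul_sum]
    apply Finset.sum_congr rfl; intro i _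
    rw [Finset.sum_comm, Finset.mul_sum]
    apply Finset.sum_congr rfl; intro j _
    rw [Finset.mul_sum, Finset.mul_sum, Finset.sum_mul]
    apply Finset.sum_congr rfl; intro c _
    ring
  · apply Finset.sum_congr rfl; intro i _
    ring

/-! ### The doubled functional and the inequality at an interior maximum -/

/-- The doubled functional. -/
def GG {n m : ℕ} (u v : ℝ → ES n → ES m) (j : Fin n) (lm K M et κ ap bp : ℝ)
    (t : ℝ) (x y : ES n) : ℝ :=
  Real.exp (lm * t) * (∑ k, (u t x k - v t y k) ^ 2 - K * ∑ i, (x i - y i) ^ 2)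
    - M * (Real.exp (-κ * (x j - ap)) + Real.exp (κ * (x j - bp))) - et

lemma GG_line {n m : ℕ} {u v : ℝ → ES n → ES m} {j : Fin n} {lm K M et κ ap bp : ℝ}
    {t : ℝ} {x y ξ ζ : ES n} {u1 u2 v1 v2 : Fin m → ℝ}
    (hu : ∀ k, J2 (fun s => u t (x + s • ξ) k) (u1 k) (u2 k))
    (hv : ∀ k, J2 (fun s => v t (y + s • ζ) k) (v1 k) (v2 k)) :
    J2 (fun s => GG u v j lm K M et κ ap bp t (x + s • ξ) (y + s • ζ))
      (Real.exp (lm * t) * (∑ k, 2 * (u t x k - v t y k) * (u1 k - v1 k)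
          - K * ∑ i, 2 * (x i - y i) * (ξ i - ζ i))
        - M * ((-κ * ξ j) * Real.exp (-κ * (x j - ap)) + (κ * ξ j) * Real.exp (κ * (x j - bp))))
      (Real.exp (lm * t) * (∑ k, (2 * (u1 k - v1 k) ^ 2 + 2 * (u t x k - v t y k) * (u2 k - v2 k))
          - K * ∑ i, 2 * (ξ i - ζ i) ^ 2)
        - M * ((-κ * ξ j) ^ 2 * Real.exp (-κ * (x j - ap))
            + (κ * ξ j) ^ 2 * Real.exp (κ * (x j - bp)))) := by
  have h1 := J2.sum Finset.univ fun k => ((hu k).sub (hv k)).sq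
  have h2 := J2.sum Finset.univ fun i : Fin n => (J2.affine (x i - y i) (ξ i - ζ i)).sq
  have h3 := (J2.exp (-κ * (x j - ap)) (-κ * ξ j)).add (J2.exp (κ * (x j - bp)) (κ * ξ j))
  have h4 := ((((h1.sub (h2.const_mul K)).const_mul (Real.exp (lm * t))).sub
    (h3.const_mul M)).sub (J2.const et))
  convert h4 using 1
  · funext s
    simp only [GG, PiLp.add_apply, PiLp.smul_apply, smul_eq_mul]
    have a1 : ∀ i, x i + s * ξ i - (y i + s * ζ i) = x i - y i + s * (ξ i - ζ i) := by
      intro i; ring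
    have a2 : -κ * (x j + s * ξ j - ap) = -κ * (x j - ap) + s * (-κ * ξ j) := by ring
    have a3 : κ * (x j + s * ξ j - bp) = κ * (x j - bp) + s * (κ * ξ j) := by ring
    simp only [a1, a2, a3]
  · simp
  · simp

lemma GG_time {n m : ℕ} {u v : ℝ → ES n → ES m} {j : Fin n} {lm K M et κ ap bp : ℝ}
    {t : ℝ} {x y : ES n} {ut vt : Fin m → ℝ}
    (hu : ∀ k, HasDerivAt (fun s => u s x k) (ut k) t)
    (hv : ∀ k, HasDerivAt (fun s => v s y k) (vt k) t) :
    HasDerivAt (fun s => GG u v j lm K M et κ ap bp s x y)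
      (lm * Real.exp (lm * t) * (∑ k, (u t x k - v t y k) ^ 2 - K * ∑ i, (x i - y i) ^ 2)
        + Real.exp (lm * t) * ∑ k, 2 * (u t x k - v t y k) * (ut k - vt k)) t := by
  have h1 : HasDerivAt (fun s => ∑ k, (u s x k - v s y k) ^ 2)
      (∑ k, 2 * (u t x k - v t y k) * (ut k - vt k)) t := by
    apply HasDerivAt.fun_sum
    intro k _
    have := ((hu k).sub (hv k)).fun_pow 2
    simpa using this
  have h0 : HasDerivAt (fun s => Real.exp (lm * s)) (lm * Real.exp (lm * t)) t := by
    have := ((hasDerivAt_id t).const_mul lm).exp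
    simpa [mul_comm] using this
  have h2 := ((h0.mul (h1.sub_const (K * ∑ i, (x i - y i) ^ 2))).sub_const
    (M * (Real.exp (-κ * (x j - ap)) + Real.exp (κ * (x j - bp))))).sub_const et
  exact h2

lemma doubled_ineq {n m d : ℕ} {u v : ℝ → ES n → ES m} {j : Fin n} {lm K M et κ ap bp T : ℝ}
    {t : ℝ} {x y β1 β2 : ES n} {ξ ζ : Fin d → ES n}
    {ut D1 E1 vt F1 H1 : Fin m → ℝ} {e D2 f F2 : Fin d → Fin m → ℝ} {r s : Fin m → ℝ}
    (u0 : ∀ k, HasDerivAt (fun s => u s x k) (ut k) t)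
    (uu : ∀ k, J2 (fun s => u t (x + s • β1) k) (D1 k) (E1 k))
    (uuu : ∀ c k, J2 (fun s => u t (x + s • ξ c) k) (e c k) (D2 c k))
    (ur : ∀ k, ut k + 2⁻¹ * ∑ c, D2 c k + D1 k + r k = 0)
    (v0 : ∀ k, HasDerivAt (fun s => v s y k) (vt k) t)
    (vv : ∀ k, J2 (fun s => v t (y + s • β2) k) (F1 k) (H1 k))
    (vvv : ∀ c k, J2 (fun s => v t (y + s • ζ c) k) (f c k) (F2 c k))
    (vr : ∀ k, vt k + 2⁻¹ * ∑ c, F2 c k + F1 k + s k = 0)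
    (htT : t < T)
    (mt : ∀ τ ∈ Icc t T, GG u v j lm K M et κ ap bp τ x y ≤ GG u v j lm K M et κ ap bp t x y)
    (mx : IsLocalMax (fun z : ES n × ES n => GG u v j lm K M et κ ap bp t z.1 z.2) (x, y)) :
    Real.exp (lm * t) * (lm * (∑ k, (u t x k - v t y k) ^ 2 - K * ∑ i, (x i - y i) ^ 2)
      - 2 * ∑ k, (u t x k - v t y k) * (r k - s k)
      - K * (∑ c, ∑ i, (ξ c i - ζ c i) ^ 2 + 2 * ∑ i, (x i - y i) * (β1 i - β2 i)))
    ≤ M * (2⁻¹ * ∑ c, (κ * ξ c j) ^ 2 * (Real.exp (-κ * (x j - ap)) + Real.exp (κ * (x j - bp)))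
        + κ * β1 j * (Real.exp (κ * (x j - bp)) - Real.exp (-κ * (x j - ap)))) := by
  have lmax : ∀ a b : ES n, IsLocalMax
      (fun s : ℝ => GG u v j lm K M et κ ap bp t (x + s • a) (y + s • b)) 0 := by
    intro a b
    have := ((line_tendsto x a).prodMk_nhds (line_tendsto y b)).eventually mx
    filter_upwards [this] with s hs
    simpa using hs
  have T0 := deriv_nonpos_of_right_max (GG_time (j := j) (lm := lm) (K := K) (M := M) (et := et)
    (κ := κ) (ap := ap) (bp := bp) u0 v0) htT mt
  have T1 := (lmax β1 β2).hasDerivAt_eq_zero (GG_line uu vv).hasDerivAt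
  have T2 : ∀ c, _ := fun c => (GG_line (j := j) (lm := lm) (K := K) (M := M) (et := et)
    (κ := κ) (ap := ap) (bp := bp) (uuu c) (vvv c)).nonpos (lmax (ξ c) (ζ c))
  have T2' := Finset.sum_nonpos fun c (_ : c ∈ Finset.univ) => T2 c
  rw [Finset.sum_sub_distrib, ← Finset.mul_sum, ← Finset.mul_sum, Finset.sum_sub_distrib,
    ← Finset.mul_sum, Finset.sum_comm] at T2'
  set A := Real.exp (lm * t)
  set P := Real.exp (-κ * (x j - ap))
  set R := Real.exp (κ * (x j - bp))
  have hA : 0 < A := Real.exp_pos _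
  have q1 : ∑ k, 2 * (u t x k - v t y k) * (ut k - vt k)
      + 2⁻¹ * ∑ k, ∑ c, (2 * (e c k - f c k) ^ 2
          + 2 * (u t x k - v t y k) * (D2 c k - F2 c k))
      + ∑ k, 2 * (u t x k - v t y k) * (D1 k - F1 k)
      ≥ - (2 * ∑ k, (u t x k - v t y k) * (r k - s k)) := by
    rw [Finset.mul_sum, Finset.mul_sum, ← Finset.sum_add_distrib, ← Finset.sum_add_distrib,
      ← Finset.sum_neg_distrib]
    apply Finset.sum_le_sum
    intro k _
    rw [Finset.sum_add_distrib, ← Finset.mul_sum, ← Finset.mul_sum, Finset.sum_sub_distrib]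
    have z : 0 ≤ ∑ c, (e c k - f c k) ^ 2 := Finset.sum_nonneg fun c _ => sq_nonneg _
    have a1 := ur k
    have a2 := vr k
    have : r k - s k = -((ut k - vt k) + 2⁻¹ * (∑ c, D2 c k - ∑ c, F2 c k) + (D1 k - F1 k)) := by
      linarith
    rw [this]
    nlinarith
  have q2 : ∑ c, ((-κ * ξ c j) ^ 2 * P + (κ * ξ c j) ^ 2 * R)
      = ∑ c, (κ * ξ c j) ^ 2 * (P + R) := by
    apply Finset.sum_congr rfl; intro c _; ring
  have q3 : ∑ c, ∑ i, 2 * (ξ c i - ζ c i) ^ 2 = 2 * ∑ c, ∑ i, (ξ c i - ζ c i) ^ 2 := by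
    simp only [Finset.mul_sum]
  have q4 : ∑ i, 2 * (x i - y i) * (β1 i - β2 i) = 2 * ∑ i, (x i - y i) * (β1 i - β2 i) := by
    rw [Finset.mul_sum]; apply Finset.sum_congr rfl; intro c _; ring
  rw [q2, q3] at T2'
  rw [q4] at T1
  have q5 := mul_le_mul_of_nonneg_left q1 hA.le
  generalize ∑ k, 2 * (u t x k - v t y k) * (ut k - vt k) = X1 at *
  generalize (∑ k, ∑ c, (2 * (e c k - f c k) ^ 2
          + 2 * (u t x k - v t y k) * (D2 c k - F2 c k))) = X2 at *
  generalize (∑ k, 2 * (u t x k - v t y k) * (D1 k - F1 k)) = X3 at *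
  generalize (∑ k, (u t x k - v t y k) * (r k - s k)) = X4 at *
  generalize (∑ c, ∑ i, (ξ c i - ζ c i) ^ 2) = X5 at *
  generalize (∑ i, (x i - y i) * (β1 i - β2 i)) = X6 at *
  generalize (∑ c, (κ * ξ c j) ^ 2 * (P + R)) = X7 at *
  nlinarith

lemma sum_mul_le_norm {n : ℕ} (a b : ES n) : |∑ i, a i * b i| ≤ ‖a‖ * ‖b‖ := by
  have h := abs_real_inner_le_norm a b
  simp only [PiLp.inner_apply, RCLike.inner_apply, conj_trivial] at h
  simpa [mul_comm] using h

set_option maxHeartbeats 2000000 in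
/-- Comparison principle for the doubled functional. -/
lemma doubled_comparison {n m d : ℕ} {T : ℝ}
    (σ : ℝ → ES n → ES m → Matrix (Fin n) (Fin d) ℝ)
    (b : ℝ → ES n → ES m → ES n) (bh : ℝ → ES n → ES m → ES m)
    {Q O : Set (ES n)} (hQ : IsOpen Q) (hO : IsOpen O) (hQO : Q ⊆ O)
    (cQ : IsCompact (closure Q)) (cO : IsCompact (closure O))
    {u v : ℝ → ES n → ES m}
    (hu : IsSolOn T (halfSigmaSigmaT σ) b bh Q u)
    (hv : IsSolOn T (halfSigmaSigmaT σ) b bh O v)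
    (j : Fin n) {lm K M κ ap bp L Lv S B : ℝ}
    (hL : 0 ≤ L) (hLv : 0 ≤ Lv) (hM : 0 ≤ M) (hκ : 0 ≤ κ)
    (hK1 : 1 ≤ K) (hK : 8 * Lv ^ 2 ≤ K)
    (lbh : ∀ t x y w w', ‖bh t x w - bh t y w'‖ ≤ L * (‖x - y‖ + ‖w - w'‖))
    (lb : ∀ t x y w w', ‖b t x w - b t y w'‖ ≤ L * (‖x - y‖ + ‖w - w'‖))
    (lσ : ∀ t x y w w' i c, |σ t x w i c - σ t y w' i c| ≤ L * (‖x - y‖ + ‖w - w'‖))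
    (bσ : ∀ t ∈ Ioo 0 T, ∀ x ∈ Q, ∀ c, |σ t x (u t x) j c| ≤ S)
    (bb : ∀ t ∈ Ioo 0 T, ∀ x ∈ Q, |b t x (u t x) j| ≤ B)
    (lv : ∀ t ∈ Ioo 0 T, ∀ x ∈ closure O, ∀ y ∈ closure O, ‖v t x - v t y‖ ≤ Lv * ‖x - y‖)
    (hlm : 2 * (4 * L + K * (4 * d * n * L ^ 2 + 4 * L)) + (2⁻¹ * d * κ ^ 2 * S ^ 2 + κ * B) < lm)
    (hbd : ∀ t ∈ Ioc 0 T, ∀ x ∈ closure Q, ∀ y ∈ closure O, ¬ (t < T ∧ x ∈ Q ∧ y ∈ O) →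
      Real.exp (lm * t) * (‖u t x - v t y‖ ^ 2 - K * ‖x - y‖ ^ 2)
        ≤ M * (Real.exp (-κ * (x j - ap)) + Real.exp (κ * (x j - bp)))) :
    ∀ t ∈ Ioc 0 T, ∀ x ∈ closure Q, ∀ y ∈ closure O,
      Real.exp (lm * t) * (‖u t x - v t y‖ ^ 2 - K * ‖x - y‖ ^ 2)
        ≤ M * (Real.exp (-κ * (x j - ap)) + Real.exp (κ * (x j - bp))) := by
  intro t0 ht0 x0 hx0 y0 hy0
  by_contra hcon
  push Not at hcon
  obtain ⟨et, het, hcon⟩ : ∃ et > 0, M * (Real.exp (-κ * (x0 j - ap)) + Real.exp (κ * (x0 j - bp)))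
      + et < Real.exp (lm * t0) * (‖u t0 x0 - v t0 y0‖ ^ 2 - K * ‖x0 - y0‖ ^ 2) := by
    obtain ⟨c, hc1, hc2⟩ := exists_between hcon
    exact ⟨_, sub_pos.2 hc1, by linarith⟩
  have hG : ∀ t x y, GG u v j lm K M et κ ap bp t x y =
      Real.exp (lm * t) * (‖u t x - v t y‖ ^ 2 - K * ‖x - y‖ ^ 2)
      - M * (Real.exp (-κ * (x j - ap)) + Real.exp (κ * (x j - bp))) - et := by
    intro t x y
    simp only [GG, EuclideanSpace.real_norm_sq_eq, PiLp.sub_apply]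
  have hcomp : IsCompact (Icc t0 T ×ˢ closure Q ×ˢ closure O) := isCompact_Icc.prod (cQ.prod cO)
  have hcont : ContinuousOn (fun z : ℝ × ES n × ES n => GG u v j lm K M et κ ap bp z.1 z.2.1 z.2.2)
      (Icc t0 T ×ˢ closure Q ×ˢ closure O) := by
    simp only [hG]
    have c1 : ContinuousOn (fun z : ℝ × ES n × ES n => u z.1 z.2.1)
        (Icc t0 T ×ˢ closure Q ×ˢ closure O) := by
      apply hu.1.comp (f := fun z : ℝ × ES n × ES n => (z.1, z.2.1)) (by fun_prop)
      rintro ⟨t, x, y⟩ ⟨h1, h2, h3⟩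
      exact ⟨⟨ht0.1.le.trans h1.1, h1.2⟩, h2⟩
    have c2 : ContinuousOn (fun z : ℝ × ES n × ES n => v z.1 z.2.2)
        (Icc t0 T ×ˢ closure Q ×ˢ closure O) := by
      apply hv.1.comp (f := fun z : ℝ × ES n × ES n => (z.1, z.2.2)) (by fun_prop)
      rintro ⟨t, x, y⟩ ⟨h1, h2, h3⟩
      exact ⟨⟨ht0.1.le.trans h1.1, h1.2⟩, h3⟩
    have c3 := (c1.sub c2).norm
    fun_prop
  obtain ⟨⟨t, x, y⟩, ⟨h1, h2, h3⟩, hmax⟩ := hcomp.exists_isMaxOn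
    ⟨(t0, x0, y0), ⟨le_refl _, ht0.2⟩, hx0, hy0⟩ hcont
  simp only at h1 h2 h3
  have hmax' : ∀ τ ∈ Icc t0 T, ∀ a ∈ closure Q, ∀ c ∈ closure O,
      GG u v j lm K M et κ ap bp τ a c ≤ GG u v j lm K M et κ ap bp t x y :=
    fun τ hτ a ha c hc => hmax (show (τ, a, c) ∈ _ from ⟨hτ, ha, hc⟩)
  have hpos : 0 < GG u v j lm K M et κ ap bp t x y := by
    refine lt_of_lt_of_le ?_ (hmax' t0 ⟨le_rfl, ht0.2⟩ x0 hx0 y0 hy0)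
    rw [hG]; linarith
  have hpos' := hpos
  rw [hG] at hpos'
  have htI : t ∈ Ioc 0 T := ⟨ht0.1.trans_le h1.1, h1.2⟩
  have hinn : t < T ∧ x ∈ Q ∧ y ∈ O := by
    by_contra hc
    have := hbd t htI x h2 y h3 hc
    linarith
  obtain ⟨htT, hxQ, hyO⟩ := hinn
  have htO : t ∈ Ioo 0 T := ⟨htI.1, htT⟩
  obtain ⟨ut, D1, E1, e, D2, u0, uu, uuu, ur⟩ := sol_jets σ b bh hQ hu.2 htO hxQ
  obtain ⟨vt, F1, H1, f, F2, v0, vv, vvv, vr⟩ := sol_jets σ b bh hO hv.2 htO hyO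
  have mx : IsLocalMax (fun z : ES n × ES n => GG u v j lm K M et κ ap bp t z.1 z.2) (x, y) := by
    have : Q ×ˢ O ∈ nhds (x, y) := prod_mem_nhds (hQ.mem_nhds hxQ) (hO.mem_nhds hyO)
    filter_upwards [this] with z hz
    exact hmax' t h1 _ (subset_closure hz.1) _ (subset_closure hz.2)
  have key := doubled_ineq u0 uu uuu ur v0 vv vvv vr htT
    (fun τ hτ => hmax' τ ⟨h1.1.trans hτ.1, hτ.2⟩ x h2 y h3) mx
  -- comparison with the diagonal
  have hdiag := hmax' t h1 x h2 x (subset_closure (hQO hxQ))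
  rw [hG, hG] at hdiag
  set A := Real.exp (lm * t)
  have hA : 0 < A := Real.exp_pos _
  have hd1 : ‖u t x - v t x‖ ^ 2 ≤ ‖u t x - v t y‖ ^ 2 - K * ‖x - y‖ ^ 2 := by
    have : A * (‖u t x - v t x‖ ^ 2 - K * ‖x - x‖ ^ 2)
      ≤ A * (‖u t x - v t y‖ ^ 2 - K * ‖x - y‖ ^ 2) := by linarith
    have := le_of_mul_le_mul_left this hA
    simpa using this
  have hd2 : ‖u t x - v t y‖ ≤ ‖u t x - v t x‖ + Lv * ‖x - y‖ := by
    have e1 : u t x - v t y = (u t x - v t x) + (v t x - v t y) := by abel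
    rw [e1]
    exact (norm_add_le _ _).trans (by
      gcongr
      exact lv t htO x (subset_closure (hQO hxQ)) y h3)
  set U := ‖u t x - v t y‖ with hUdef
  set U' := ‖u t x - v t x‖
  set r := ‖x - y‖ with hrdef
  have hU : 0 ≤ U := norm_nonneg _
  have hU' : 0 ≤ U' := norm_nonneg _
  have hr : 0 ≤ r := norm_nonneg _
  have hU'U : U' ≤ U := by
    have : U' ^ 2 ≤ U ^ 2 := by nlinarith [sq_nonneg r]
    exact le_of_sq_le_sq this hU
  have hr1 : K * r ≤ 2 * Lv * U := by
    rcases hr.eq_or_lt with h0 | h0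
    · rw [← h0]; simp; positivity
    · have : K * r * r ≤ 2 * Lv * U * r := by nlinarith [mul_nonneg hLv hr]
      exact le_of_mul_le_mul_right this h0
  have hKr : K * r ^ 2 ≤ 2⁻¹ * U ^ 2 := by
    have a1 : (K * r) ^ 2 ≤ (2 * Lv * U) ^ 2 := pow_le_pow_left₀ (by positivity) hr1 2
    have a2 : K * (K * r ^ 2) ≤ K * (2⁻¹ * U ^ 2) := by
      have a3 := mul_le_mul_of_nonneg_right hK (sq_nonneg U)
      calc K * (K * r ^ 2) = (K * r) ^ 2 := by ring
        _ ≤ (2 * Lv * U) ^ 2 := a1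
        _ = 2⁻¹ * (8 * Lv ^ 2 * U ^ 2) := by ring
        _ ≤ 2⁻¹ * (K * U ^ 2) := by linarith
        _ = _ := by ring
    exact le_of_mul_le_mul_left a2 (by linarith)
  have hrU : r ≤ U := by
    have : r ^ 2 ≤ U ^ 2 := by nlinarith [sq_nonneg r, sq_nonneg U]
    exact le_of_sq_le_sq this hU
  have hΦ : U ^ 2 ≤ 2 * (U ^ 2 - K * r ^ 2) := by linarith
  -- estimate the terms
  have n1 : ∑ k, (u t x k - v t y k) ^ 2 = U ^ 2 := by
    rw [hUdef, EuclideanSpace.real_norm_sq_eq]; simp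
  have n2 : ∑ i, (x i - y i) ^ 2 = r ^ 2 := by
    rw [hrdef, EuclideanSpace.real_norm_sq_eq]; simp
  rw [n1, n2] at key
  have k1 : ∑ k, (u t x k - v t y k) * (bh t x (u t x) k - bh t y (v t y) k) ≤ 2 * L * U ^ 2 := by
    have a := sum_mul_le_norm (u t x - v t y) (bh t x (u t x) - bh t y (v t y))
    simp only [PiLp.sub_apply] at a
    have a2 := lbh t x y (u t x) (v t y)
    rw [← hrdef, ← hUdef] at a2
    rw [← hUdef] at a
    have a3 : U * ‖bh t x (u t x) - bh t y (v t y)‖ ≤ U * (L * (U + U)) := by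
      gcongr
      exact a2.trans (by gcongr)
    linarith [le_abs_self (∑ k, (u t x k - v t y k) * (bh t x (u t x) k - bh t y (v t y) k))]
  have k2 : ∑ i, (x i - y i) * (b t x (u t x) i - b t y (v t y) i) ≤ 2 * L * U ^ 2 := by
    have a := sum_mul_le_norm (x - y) (b t x (u t x) - b t y (v t y))
    simp only [PiLp.sub_apply] at a
    have a2 := lb t x y (u t x) (v t y)
    rw [← hrdef, ← hUdef] at a2
    rw [← hrdef] at a
    have a3 : r * ‖b t x (u t x) - b t y (v t y)‖ ≤ U * (L * (U + U)) := by
      gcongr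
      exact a2.trans (by gcongr)
    linarith [le_abs_self (∑ i, (x i - y i) * (b t x (u t x) i - b t y (v t y) i))]
  have k3 : ∑ c, ∑ i, (σ t x (u t x) i c - σ t y (v t y) i c) ^ 2 ≤ 4 * d * n * L ^ 2 * U ^ 2 := by
    have : ∀ c i, (σ t x (u t x) i c - σ t y (v t y) i c) ^ 2 ≤ 4 * L ^ 2 * U ^ 2 := by
      intro c i
      have a := lσ t x y (u t x) (v t y) i c
      rw [← hrdef, ← hUdef] at a
      have a2 : |σ t x (u t x) i c - σ t y (v t y) i c| ≤ L * (U + U) := a.trans (by gcongr)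
      rw [← sq_abs]
      calc |σ t x (u t x) i c - σ t y (v t y) i c| ^ 2 ≤ (L * (U + U)) ^ 2 := by gcongr
        _ = _ := by ring
    calc _ ≤ ∑ c : Fin d, ∑ i : Fin n, 4 * L ^ 2 * U ^ 2 :=
          Finset.sum_le_sum fun c _ => Finset.sum_le_sum fun i _ => this c i
      _ = _ := by simp; ring
  set P := Real.exp (-κ * (x j - ap))
  set R := Real.exp (κ * (x j - bp))
  have hP : 0 < P := Real.exp_pos _
  have hR : 0 < R := Real.exp_pos _
  have k4 : ∑ c, (κ * σ t x (u t x) j c) ^ 2 * (P + R) ≤ d * κ ^ 2 * S ^ 2 * (P + R) := by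
    calc _ ≤ ∑ c : Fin d, κ ^ 2 * S ^ 2 * (P + R) := by
          apply Finset.sum_le_sum; intro c _
          have a1 : |σ t x (u t x) j c| ^ 2 ≤ S ^ 2 :=
            pow_le_pow_left₀ (abs_nonneg _) (bσ t htO x hxQ c) 2
          rw [sq_abs] at a1
          rw [mul_pow]
          have a2 := mul_le_mul_of_nonneg_left a1 (sq_nonneg κ)
          exact mul_le_mul_of_nonneg_right a2 (by positivity)
      _ = _ := by simp; ring
  have k5 : κ * b t x (u t x) j * (R - P) ≤ κ * B * (P + R) := by
    have a := bb t htO x hxQ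
    have hB : 0 ≤ B := (abs_nonneg _).trans a
    have a2 : b t x (u t x) j * (R - P) ≤ B * (P + R) := by
      calc _ ≤ |b t x (u t x) j * (R - P)| := le_abs_self _
        _ = |b t x (u t x) j| * |R - P| := abs_mul _ _
        _ ≤ B * (P + R) := by
          gcongr
          rw [abs_le]; constructor <;> linarith
    rw [mul_assoc, mul_assoc]
    gcongr
  simp only at key
  set C1 := 4 * L + K * (4 * d * n * L ^ 2 + 4 * L) with hC1
  have hC1p : 0 ≤ C1 := by positivity
  set AA := 2⁻¹ * d * κ ^ 2 * S ^ 2 + κ * B with hAA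
  have hAAp : 0 ≤ AA := by
    have hB : 0 ≤ B := (abs_nonneg _).trans (bb t htO x hxQ)
    positivity
  have key2 : A * (lm * (U ^ 2 - K * r ^ 2) - C1 * U ^ 2) ≤ AA * (M * (P + R)) := by
    refine le_trans ?_ (key.trans ?_)
    · apply mul_le_mul_of_nonneg_left _ hA.le
      have := mul_le_mul_of_nonneg_left (add_le_add k3 (mul_le_mul_of_nonneg_left k2 zero_le_two))
        (zero_le_one.trans hK1)
      rw [hC1]
      linarith
    · calc _ ≤ M * (2⁻¹ * (d * κ ^ 2 * S ^ 2 * (P + R)) + κ * B * (P + R)) := by gcongr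
        _ = _ := by rw [hAA]; ring
  set Φ := U ^ 2 - K * r ^ 2
  have hM2 : M * (P + R) < A * Φ := by linarith
  have hAΦ : 0 < A * Φ := lt_of_le_of_lt (by positivity) hM2
  have s1 : AA * (M * (P + R)) ≤ AA * (A * Φ) := by gcongr
  have s2 : A * (C1 * U ^ 2) ≤ A * (C1 * (2 * Φ)) := by gcongr
  have s3 := mul_lt_mul_of_pos_right hlm hAΦ
  clear_value Φ AA C1 A P R U r
  linarith

/-! ### Boundary barriers -/

lemma g_jet {n m : ℕ} {g : ES n → ES m} (hg : ContDiff ℝ 2 g) (x ξ : ES n) (k : Fin m) :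
    J2 (fun s => g (x + s • ξ) k) (fderiv ℝ g x ξ k) (fderiv ℝ (fderiv ℝ g) x ξ ξ k) := by
  have hl : ∀ s : ℝ, HasDerivAt (fun s : ℝ => x + s • ξ) ξ s := by
    intro s
    simpa using ((hasDerivAt_id s).smul_const ξ).const_add x
  have hd : Differentiable ℝ g := hg.differentiable (by norm_num)
  have hd2 : Differentiable ℝ (fderiv ℝ g) :=
    (hg.fderiv_right (m := 1) (by norm_num)).differentiable (by norm_num)
  refine ⟨fun s => fderiv ℝ g (x + s • ξ) ξ k, Filter.Eventually.of_forall fun s => ?_, by simp, ?_⟩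
  · have h1 : HasDerivAt (fun s : ℝ => g (x + s • ξ)) (fderiv ℝ g (x + s • ξ) ξ) s :=
      (hd (x + s • ξ)).hasFDerivAt.comp_hasDerivAt s (hl s)
    exact (EuclideanSpace.proj (𝕜 := ℝ) k).hasFDerivAt.comp_hasDerivAt s h1
  · have h1 : HasDerivAt (fun s : ℝ => fderiv ℝ g (x + s • ξ))
        (fderiv ℝ (fderiv ℝ g) (x + (0 : ℝ) • ξ) ξ) 0 :=
      (hd2 (x + (0 : ℝ) • ξ)).hasFDerivAt.comp_hasDerivAt 0 (hl 0)
    have h2 := h1.clm_apply (hasDerivAt_const (0 : ℝ) ξ)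
    have h3 := (EuclideanSpace.proj (𝕜 := ℝ) k).hasFDerivAt.comp_hasDerivAt 0 h2
    simpa [Function.comp_def] using h3

lemma abs_coord_le {n : ℕ} (x : ES n) (i : Fin n) : |x i| ≤ ‖x‖ := by
  simpa using PiLp.norm_apply_le x i

set_option maxHeartbeats 1000000 in
lemma barrier_comparison {n m d : ℕ} {T : ℝ}
    (σ : ℝ → ES n → ES m → Matrix (Fin n) (Fin d) ℝ)
    (b : ℝ → ES n → ES m → ES n) (bh : ℝ → ES n → ES m → ES m)
    {Q : Set (ES n)} (hQ : IsOpen Q) (cQ : IsCompact (closure Q))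
    {u : ℝ → ES n → ES m} (hu : IsSolOn T (halfSigmaSigmaT σ) b bh Q u)
    {g : ES n → ES m} (hg : ContDiff ℝ 2 g) {Kg : ℝ}
    (hg1 : ∀ x, ‖fderiv ℝ g x‖ ≤ Kg) (hg2 : ∀ x, ‖fderiv ℝ (fderiv ℝ g) x‖ ≤ Kg)
    (k : Fin m) (i : Fin n) {sg e l N γ ν0 S B H : ℝ} (hsg : sg = 1 ∨ sg = -1)
    (he : e = 1 ∨ e = -1) (hγ : 0 < γ) (hN : 0 ≤ N)
    (hdist : ∀ x ∈ Q, l - e * x i ≤ 2 * l)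
    (ellip : ∀ t ∈ Ioo 0 T, ∀ x ∈ Q, ν0 ≤ ∑ c, σ t x (u t x) i c ^ 2)
    (bσ : ∀ t ∈ Ioo 0 T, ∀ x ∈ Q, ∀ i c, |σ t x (u t x) i c| ≤ S)
    (bb : ∀ t ∈ Ioo 0 T, ∀ x ∈ Q, ‖b t x (u t x)‖ ≤ B)
    (bbh : ∀ t ∈ Ioo 0 T, ∀ x ∈ Q, ‖bh t x (u t x)‖ ≤ H)
    (hγ1 : 1 ≤ 2⁻¹ * γ ^ 2 * ν0 - γ * B)
    (hN1 : H + Kg * (2⁻¹ * d * n * S ^ 2) + Kg * B < N * Real.exp (-γ * (2 * l)))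
    (hbd : ∀ t ∈ Ioc 0 T, ∀ x ∈ closure Q, ¬ (t < T ∧ x ∈ Q) →
      sg * (u t x k - g x k) ≤ N * (1 - Real.exp (-γ * (l - e * x i)))) :
    ∀ t ∈ Ioc 0 T, ∀ x ∈ closure Q,
      sg * (u t x k - g x k) ≤ N * (1 - Real.exp (-γ * (l - e * x i))) := by
  intro t0 ht0 x0 hx0
  by_contra hcon
  push Not at hcon
  set F : ℝ → ES n → ℝ := fun t x =>
    sg * (u t x k - g x k) + N * Real.exp (-γ * (l - e * x i)) - N with hF
  have hcont : ContinuousOn (fun z : ℝ × ES n => F z.1 z.2) (Icc t0 T ×ˢ closure Q) := by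
    have c1 : ContinuousOn (fun z : ℝ × ES n => u z.1 z.2) (Icc t0 T ×ˢ closure Q) :=
      hu.1.mono (prod_mono (Icc_subset_Icc_left ht0.1.le) le_rfl)
    have c2 : ContinuousOn (fun z : ℝ × ES n => u z.1 z.2 k) (Icc t0 T ×ˢ closure Q) :=
      (EuclideanSpace.proj (𝕜 := ℝ) k).continuous.comp_continuousOn c1
    have c3 : Continuous (fun z : ℝ × ES n => g z.2 k) :=
      (EuclideanSpace.proj (𝕜 := ℝ) k).continuous.comp (hg.continuous.comp continuous_snd)
    have c4 : Continuous (fun z : ℝ × ES n => N * Real.exp (-γ * (l - e * z.2 i))) := by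
      have : Continuous (fun z : ℝ × ES n => z.2 i) :=
        (EuclideanSpace.proj (𝕜 := ℝ) i).continuous.comp continuous_snd
      fun_prop
    exact ((continuousOn_const.mul (c2.sub c3.continuousOn)).add c4.continuousOn).sub
      continuousOn_const
  obtain ⟨⟨t, x⟩, ⟨h1, h2⟩, hmax⟩ := (isCompact_Icc.prod cQ).exists_isMaxOn
    ⟨(t0, x0), ⟨le_refl _, ht0.2⟩, hx0⟩ hcont
  simp only at h1 h2
  have hmax' : ∀ τ ∈ Icc t0 T, ∀ a ∈ closure Q, F τ a ≤ F t x :=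
    fun τ hτ a ha => hmax (show (τ, a) ∈ _ from ⟨hτ, ha⟩)
  have hpos : 0 < F t x := by
    refine lt_of_lt_of_le ?_ (hmax' t0 ⟨le_rfl, ht0.2⟩ x0 hx0)
    simp only [hF]; linarith
  have htI : t ∈ Ioc 0 T := ⟨ht0.1.trans_le h1.1, h1.2⟩
  have hinn : t < T ∧ x ∈ Q := by
    by_contra hc
    have := hbd t htI x h2 hc
    simp only [hF] at hpos
    linarith
  obtain ⟨htT, hxQ⟩ := hinn
  have htO : t ∈ Ioo 0 T := ⟨htI.1, htT⟩
  obtain ⟨ut, D1, E1, f, D2, u0, uu, uuu, ur⟩ := sol_jets σ b bh hQ hu.2 htO hxQ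
  have T0 : sg * ut k ≤ 0 := by
    have hd : HasDerivAt (fun τ => F τ x) (sg * ut k) t := by
      simp only [hF]
      exact ((((u0 k).sub_const _).const_mul sg).add_const _).sub_const _
    exact deriv_nonpos_of_right_max hd htT fun τ hτ => hmax' τ ⟨h1.1.trans hτ.1, hτ.2⟩ x h2
  have lmax : ∀ ξ : ES n, IsLocalMax (fun s : ℝ => F t (x + s • ξ)) 0 := by
    intro ξ
    filter_upwards [(line_tendsto x ξ).eventually (hQ.mem_nhds hxQ)] with s hs
    simpa using hmax' t h1 _ (subset_closure hs)
  have jet : ∀ (ξ : ES n) (a1 a2 : ℝ), J2 (fun s => u t (x + s • ξ) k) a1 a2 →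
      J2 (fun s => F t (x + s • ξ))
        (sg * (a1 - fderiv ℝ g x ξ k) + N * ((γ * e * ξ i) * Real.exp (-γ * (l - e * x i))))
        (sg * (a2 - fderiv ℝ (fderiv ℝ g) x ξ ξ k)
          + N * ((γ * e * ξ i) ^ 2 * Real.exp (-γ * (l - e * x i)))) := by
    intro ξ a1 a2 h
    have := ((((h.sub (g_jet hg x ξ k)).const_mul sg).add
      ((J2.exp (-γ * (l - e * x i)) (γ * e * ξ i)).const_mul N)).sub (J2.const N))
    convert this using 1
    · funext s
      simp only [hF, PiLp.add_apply, PiLp.smul_apply, smul_eq_mul]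
      have : -γ * (l - e * (x i + s * ξ i)) = -γ * (l - e * x i) + s * (γ * e * ξ i) := by ring
      rw [this]
    · ring
    · ring
  have T1 := (lmax _).hasDerivAt_eq_zero (jet _ _ _ (uu k)).hasDerivAt
  have T2 := Finset.sum_nonpos fun c (_ : c ∈ Finset.univ) => (jet _ _ _ (uuu c k)).nonpos (lmax _)
  rw [Finset.sum_add_distrib, ← Finset.mul_sum, ← Finset.mul_sum, ← Finset.sum_mul,
    Finset.sum_sub_distrib] at T2
  set Ex := Real.exp (-γ * (l - e * x i)) with hEx
  have hExp : 0 < Ex := Real.exp_pos _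
  have hKg : 0 ≤ Kg := (norm_nonneg _).trans (hg1 0)
  have he2 : e ^ 2 = 1 := by rcases he with h | h <;> rw [h] <;> norm_num
  have hB : 0 ≤ B := (norm_nonneg _).trans (bb t htO x hxQ)
  -- bounds of the g-terms
  have g1 : |fderiv ℝ g x (b t x (u t x)) k| ≤ Kg * B := by
    refine (abs_coord_le _ k).trans ((ContinuousLinearMap.le_opNorm _ _).trans ?_)
    exact mul_le_mul (hg1 x) (bb t htO x hxQ) (norm_nonneg _) hKg
  set ξ : Fin d → ES n := fun c => WithLp.toLp 2 fun i => σ t x (u t x) i c with hξ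
  have hξn : ∀ c, ‖ξ c‖ ^ 2 ≤ n * S ^ 2 := by
    intro c
    rw [EuclideanSpace.real_norm_sq_eq]
    calc _ ≤ ∑ _j : Fin n, S ^ 2 := by
          apply Finset.sum_le_sum; intro j _
          have := pow_le_pow_left₀ (abs_nonneg _) (bσ t htO x hxQ j c) 2
          rw [sq_abs] at this
          exact this
      _ = _ := by simp
  have g2 : ∀ c, |fderiv ℝ (fderiv ℝ g) x (ξ c) (ξ c) k| ≤ Kg * (n * S ^ 2) := by
    intro c
    refine (abs_coord_le _ k).trans ((ContinuousLinearMap.le_opNorm _ _).trans ?_)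
    calc ‖fderiv ℝ (fderiv ℝ g) x (ξ c)‖ * ‖ξ c‖
        ≤ (‖fderiv ℝ (fderiv ℝ g) x‖ * ‖ξ c‖) * ‖ξ c‖ := by
          gcongr
          exact ContinuousLinearMap.le_opNorm _ _
      _ = ‖fderiv ℝ (fderiv ℝ g) x‖ * ‖ξ c‖ ^ 2 := by ring
      _ ≤ Kg * (n * S ^ 2) := mul_le_mul (hg2 x) (hξn c) (sq_nonneg _) hKg
  have g3 : |∑ c, fderiv ℝ (fderiv ℝ g) x (ξ c) (ξ c) k| ≤ d * (Kg * (n * S ^ 2)) := by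
    refine (Finset.abs_sum_le_sum_abs _ _).trans ?_
    refine (Finset.sum_le_sum fun c _ => g2 c).trans ?_
    simp
  have g4 : |bh t x (u t x) k| ≤ H := (abs_coord_le _ k).trans (bbh t htO x hxQ)
  have g5 : |b t x (u t x) i| ≤ B := (abs_coord_le _ i).trans (bb t htO x hxQ)
  have sq1 : ∑ c, (γ * e * ξ c i) ^ 2 = γ ^ 2 * ∑ c, σ t x (u t x) i c ^ 2 := by
    rw [Finset.mul_sum]; apply Finset.sum_congr rfl; intro c _
    simp only [hξ]
    calc _ = γ ^ 2 * e ^ 2 * σ t x (u t x) i c ^ 2 := by ring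
      _ = _ := by rw [he2, mul_one]
  rw [sq1] at T2
  have el := ellip t htO x hxQ
  have eb : -(γ * B) ≤ γ * e * b t x (u t x) i := by
    have := abs_le.1 g5
    have p1 := mul_le_mul_of_nonneg_left this.1 hγ.le
    have p2 := mul_le_mul_of_nonneg_left this.2 hγ.le
    rcases he with h | h <;> rw [h] <;> linarith
  have main1 : 1 ≤ 2⁻¹ * (γ ^ 2 * ∑ c, σ t x (u t x) i c ^ 2) + γ * e * b t x (u t x) i := by
    have := mul_le_mul_of_nonneg_left el (sq_nonneg γ)
    linarith
  have hExl : Real.exp (-γ * (2 * l)) ≤ Ex := by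
    apply Real.exp_le_exp.2
    have := mul_le_mul_of_nonneg_left (hdist x hxQ) hγ.le
    linarith
  have main2 : N * Real.exp (-γ * (2 * l)) ≤
      N * ((2⁻¹ * (γ ^ 2 * ∑ c, σ t x (u t x) i c ^ 2) + γ * e * b t x (u t x) i) * Ex) := by
    apply mul_le_mul_of_nonneg_left _ hN
    calc _ ≤ 1 * Ex := by rw [one_mul]; exact hExl
      _ ≤ _ := mul_le_mul_of_nonneg_right main1 hExp.le
  have r := ur k
  generalize (∑ c, D2 c k) = X1 at *
  generalize (∑ c, fderiv ℝ (fderiv ℝ g) x (ξ c) (ξ c) k) = X2 at *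
  generalize (∑ c, σ t x (u t x) i c ^ 2) = X3 at *
  generalize fderiv ℝ g x (b t x (u t x)) k = X4 at *
  generalize bh t x (u t x) k = X5 at *
  generalize b t x (u t x) i = X6 at *
  have q1 := abs_le.1 g1
  have q3 := abs_le.1 g3
  have q4 := abs_le.1 g4
  have r2 : sg * ut k + 2⁻¹ * (sg * X1) + sg * D1 k + sg * X5 = 0 := by
    linear_combination sg * r
  rcases hsg with h | h <;> subst h <;> linarith

/-! ### Geometry of boxes, Lipschitz bounds -/

/-- an open box -/
def BoxO {n : ℕ} (lo hi : Fin n → ℝ) : Set (ES n) := {x | ∀ i, x i ∈ Ioo (lo i) (hi i)}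

/-- a closed box -/
def BoxC {n : ℕ} (lo hi : Fin n → ℝ) : Set (ES n) := {x | ∀ i, x i ∈ Icc (lo i) (hi i)}

lemma isOpen_BoxO {n : ℕ} (lo hi : Fin n → ℝ) : IsOpen (BoxO lo hi) := by
  have : BoxO lo hi = (EuclideanSpace.equiv (Fin n) ℝ) ⁻¹' (Set.pi univ fun i => Ioo (lo i) (hi i)) := by
    ext x; simp [BoxO]
  rw [this]
  exact (isOpen_set_pi finite_univ fun i _ => isOpen_Ioo).preimage
    (EuclideanSpace.equiv (Fin n) ℝ).continuous

lemma BoxC_eq {n : ℕ} (lo hi : Fin n → ℝ) : BoxC lo hi =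
    (EuclideanSpace.equiv (Fin n) ℝ).toHomeomorph ⁻¹' (Set.pi univ fun i => Icc (lo i) (hi i)) := by
  ext x; simp [BoxC, Pi.le_def, forall_and]

lemma closure_BoxO {n : ℕ} {lo hi : Fin n → ℝ} (h : ∀ i, lo i < hi i) :
    closure (BoxO lo hi) = BoxC lo hi := by
  have : BoxO lo hi = (EuclideanSpace.equiv (Fin n) ℝ).toHomeomorph ⁻¹'
      (Set.pi univ fun i => Ioo (lo i) (hi i)) := by
    ext x; simp [BoxO]
  rw [this, ← Homeomorph.preimage_closure, closure_pi_set, BoxC_eq]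
  congr 2
  funext i
  exact closure_Ioo (h i).ne

lemma isCompact_BoxC {n : ℕ} (lo hi : Fin n → ℝ) : IsCompact (BoxC lo hi) := by
  rw [BoxC_eq]
  exact (Homeomorph.isCompact_preimage _).2 (isCompact_univ_pi fun i => isCompact_Icc)

lemma convex_BoxO {n : ℕ} (lo hi : Fin n → ℝ) : Convex ℝ (BoxO lo hi) := by
  intro x hx y hy a b ha hb hab i
  have := convex_Ioo (𝕜 := ℝ) (lo i) (hi i) (hx i) (hy i) ha hb hab
  simpa using this

lemma convex_BoxC {n : ℕ} (lo hi : Fin n → ℝ) : Convex ℝ (BoxC lo hi) := by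
  intro x hx y hy a b ha hb hab i
  have := convex_Icc (𝕜 := ℝ) (lo i) (hi i) (hx i) (hy i) ha hb hab
  simpa using this

lemma cube_eq {n : ℕ} (l : ℝ) : OpenCube (n := n) l = BoxO (fun _ => -l) (fun _ => l) := rfl

lemma subdom_eq {n : ℕ} (l ap bp : ℝ) : Subdom (n := n) l ap bp =
    BoxO (fun i => if i = Fin.last n then ap else -l) (fun i => if i = Fin.last n then bp else l) := by
  ext x
  simp only [Subdom, BoxO, mem_setOf_eq]
  constructor
  · rintro ⟨h1, h2⟩ i
    by_cases hi : i = Fin.last n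
    · subst hi; simpa using h2
    · simpa [hi] using h1 i hi
  · intro h
    exact ⟨fun i hi => by simpa [hi] using h i, by simpa using h (Fin.last n)⟩

lemma closure_cube {n : ℕ} {l : ℝ} (hl : 0 < l) (x : ES (n + 1)) :
    x ∈ closure (OpenCube (n := n) l) ↔ ∀ i, x i ∈ Icc (-l) l := by
  rw [cube_eq, closure_BoxO (fun _ => by linarith)]; rfl

lemma closure_subdom {n : ℕ} {l ap bp : ℝ} (hl : 0 < l) (hab : ap < bp) (x : ES (n + 1)) :
    x ∈ closure (Subdom (n := n) l ap bp) ↔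
      (∀ i, i ≠ Fin.last n → x i ∈ Icc (-l) l) ∧ x (Fin.last n) ∈ Icc ap bp := by
  rw [subdom_eq, closure_BoxO]
  · simp only [BoxC, mem_setOf_eq]
    constructor
    · intro h
      exact ⟨fun i hi => by simpa [hi] using h i, by simpa using h (Fin.last n)⟩
    · rintro ⟨h1, h2⟩ i
      by_cases hi : i = Fin.last n
      · subst hi; simpa using h2
      · simpa [hi] using h1 i hi
  · intro i
    by_cases hi : i = Fin.last n
    · simpa [hi] using hab
    · simp only [hi, if_false]; linarith

lemma isCompact_closure_subdom {n : ℕ} {l ap bp : ℝ} (hl : 0 < l) (hab : ap < bp) :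
    IsCompact (closure (Subdom (n := n) l ap bp)) := by
  rw [subdom_eq, closure_BoxO]
  · exact isCompact_BoxC _ _
  · intro i
    by_cases hi : i = Fin.last n
    · simpa [hi] using hab
    · simp only [hi, if_false]; linarith

lemma isCompact_closure_cube {n : ℕ} {l : ℝ} (hl : 0 < l) :
    IsCompact (closure (OpenCube (n := n) l)) := by
  rw [cube_eq, closure_BoxO (fun _ => by linarith)]
  exact isCompact_BoxC _ _

lemma norm_le_sum_abs {n : ℕ} (a : ES n) : ‖a‖ ≤ ∑ i, |a i| := by
  conv_lhs => rw [es_eq_sum a]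
  refine (norm_sum_le _ _).trans (Finset.sum_le_sum fun i _ => ?_)
  simp [norm_smul]

lemma norm_le_of_coord {n : ℕ} {a : ES n} {c : ℝ} (h : ∀ i, |a i| ≤ c) : ‖a‖ ≤ n * c := by
  refine (norm_le_sum_abs a).trans ((Finset.sum_le_sum fun i _ => h i).trans ?_)
  simp

lemma sol_lipschitz {n m : ℕ} {T l : ℝ} (hl : 0 < l)
    {a : ℝ → ES (n + 1) → ES m → Matrix (Fin (n + 1)) (Fin (n + 1)) ℝ}
    {b : ℝ → ES (n + 1) → ES m → ES (n + 1)} {bh : ℝ → ES (n + 1) → ES m → ES m}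
    {v : ℝ → ES (n + 1) → ES m} (hv : IsSolOn T a b bh (OpenCube l) v)
    (hd : DerivBdd T (OpenCube l) v) :
    ∃ Lv : ℝ, 0 ≤ Lv ∧ ∀ t ∈ Ioo 0 T, ∀ x ∈ closure (OpenCube (n := n) l),
      ∀ y ∈ closure (OpenCube (n := n) l), ‖v t x - v t y‖ ≤ Lv * ‖x - y‖ := by
  obtain ⟨K, hK⟩ := hd
  have hm : (0 : ℝ) ≤ m * ((n + 1 : ℕ) * |K|) := by positivity
  refine ⟨m * ((n + 1 : ℕ) * |K|), hm, ?_⟩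
  intro t ht
  have hopen : ∀ x ∈ OpenCube (n := n) l, ∀ y ∈ OpenCube (n := n) l,
      ‖v t x - v t y‖ ≤ m * ((n + 1 : ℕ) * |K|) * ‖x - y‖ := by
    intro x hx y hy
    rw [mul_assoc]
    apply norm_le_of_coord
    intro k
    have hdif : ∀ z ∈ OpenCube (n := n) l, DifferentiableAt ℝ (fun x' => v t x' k) z :=
      fun z hz => ((hv.2 t ht z hz).1 k).2.1
    have hbound : ∀ z ∈ OpenCube (n := n) l,
        ‖fderiv ℝ (fun x' => v t x' k) z‖ ≤ (n + 1 : ℕ) * |K| := by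
      intro z hz
      apply ContinuousLinearMap.opNorm_le_bound _ (by positivity)
      intro ξ
      rw [fderiv_eq_pd, Real.norm_eq_abs]
      refine (Finset.abs_sum_le_sum_abs _ _).trans ?_
      calc _ ≤ ∑ _i : Fin (n + 1), |K| * ‖ξ‖ := by
            apply Finset.sum_le_sum
            intro i _
            rw [abs_mul, mul_comm]
            have := ((hK t ht z hz k).2.2.1 i).trans (le_abs_self K)
            exact mul_le_mul this (abs_coord_le ξ i) (abs_nonneg _) (abs_nonneg _)
        _ = _ := by simp; ring
    have := (convex_BoxO (fun _ : Fin (n + 1) => -l) (fun _ => l)).norm_image_sub_le_of_norm_fderiv_le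
      hdif hbound hy hx
    simpa [Real.norm_eq_abs] using this
  have hcont : ContinuousOn (v t) (closure (OpenCube (n := n) l)) := by
    apply hv.1.comp (f := fun x : ES (n + 1) => (t, x)) (by fun_prop)
    intro x hx
    exact ⟨⟨ht.1.le, ht.2.le⟩, hx⟩
  have hlip : LipschitzOnWith (Real.toNNReal (m * ((n + 1 : ℕ) * |K|))) (v t)
      (OpenCube (n := n) l) := by
    apply LipschitzOnWith.of_dist_le_mul
    intro x hx y hy
    rw [dist_eq_norm, dist_eq_norm, Real.coe_toNNReal _ hm]
    exact hopen x hx y hy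
  have hlip' := (lipschitzOnWith_closure_iff hcont).2 hlip
  intro x hx y hy
  have := hlip'.dist_le_mul x hx y hy
  rwa [dist_eq_norm, dist_eq_norm, Real.coe_toNNReal _ hm] at this

lemma c1bdd_lip {n m : ℕ} {F : Type*} [NormedAddCommGroup F] [NormedSpace ℝ F]
    {f : ℝ → ES n → ES m → F} (h : C1Bdd (fun p : ℝ × ES n × ES m => f p.1 p.2.1 p.2.2)) :
    ∃ L : ℝ, 0 ≤ L ∧ (∀ t s x y w w', ‖f t x w - f s y w'‖ ≤ L * (|t - s| + ‖x - y‖ + ‖w - w'‖)) := by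
  obtain ⟨hc, K, hK⟩ := h
  have hK0 : 0 ≤ K := (norm_nonneg _).trans (hK 0)
  refine ⟨K, hK0, ?_⟩
  intro t s x y w w'
  have hd := hc.differentiable (by norm_num)
  have := convex_univ.norm_image_sub_le_of_norm_fderiv_le (𝕜 := ℝ) (fun p _ => hd p)
    (fun p _ => hK p) (mem_univ (s, y, w')) (mem_univ (t, x, w))
  refine this.trans ?_
  gcongr
  simp only [Prod.mk_sub_mk, Prod.norm_mk, Real.norm_eq_abs]
  have h1 := abs_nonneg (t - s)
  have h2 := norm_nonneg (x - y)
  have h3 := norm_nonneg (w - w')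
  refine max_le (by linarith) (max_le (by linarith) (by linarith))

lemma g_lip {n m : ℕ} {g : ES n → ES m} (h : C1Bdd g) :
    ∃ L : ℝ, 0 ≤ L ∧ ∀ x y, ‖g x - g y‖ ≤ L * ‖x - y‖ := by
  obtain ⟨hc, K, hK⟩ := h
  have hK0 : 0 ≤ K := (norm_nonneg _).trans (hK 0)
  refine ⟨K, hK0, ?_⟩
  intro x y
  exact convex_univ.norm_image_sub_le_of_norm_fderiv_le (𝕜 := ℝ)
    (fun p _ => hc.differentiable (by norm_num) p) (fun p _ => hK p) (mem_univ y) (mem_univ x)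

lemma smooth_lip_cube {n m : ℕ} {l : ℝ} {f : ES n → ES m} (h : ContDiff ℝ (⊤ : ℕ∞) f) :
    ∃ L : ℝ, 0 ≤ L ∧ ∀ x ∈ BoxC (n := n) (fun _ => -l) (fun _ => l),
      ∀ y ∈ BoxC (n := n) (fun _ => -l) (fun _ => l), ‖f x - f y‖ ≤ L * ‖x - y‖ := by
  have hc : Continuous (fderiv ℝ f) := h.continuous_fderiv (by norm_num)
  obtain ⟨K, hK⟩ := (isCompact_BoxC (n := n) (fun _ => -l) (fun _ => l)).exists_bound_of_continuousOn
    hc.continuousOn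
  refine ⟨|K|, abs_nonneg _, ?_⟩
  intro x hx y hy
  exact (convex_BoxC _ _).norm_image_sub_le_of_norm_fderiv_le (𝕜 := ℝ)
    (fun p _ => h.differentiable (by norm_num) p) (fun p hp => (hK p hp).trans (le_abs_self K)) hy hx

/-! ### The partition -/

/-- quantitative consequences of the partition hypotheses -/
structure Geo (I : ℕ) (l δ0 : ℝ) (aa bb : ℕ → ℝ) : Prop where
  pos : 0 < δ0
  hl : 0 < l
  lt : ∀ p, 1 ≤ p → p ≤ I → aa p < bb p
  a_ge : ∀ p, 1 ≤ p → p ≤ I → -l ≤ aa p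
  b_le : ∀ p, 1 ≤ p → p ≤ I → bb p ≤ l
  a1 : aa 1 = -l
  bI : bb I = l
  aa_step : ∀ p, 1 ≤ p → p < I → aa p + δ0 ≤ aa (p + 1)
  ab_step : ∀ p, 1 ≤ p → p < I → aa (p + 1) + δ0 ≤ bb p
  bb_step : ∀ p, 1 ≤ p → p < I → bb p + δ0 ≤ bb (p + 1)

lemma exists_gap (f : ℕ → ℝ) (J : ℕ) (h : ∀ p, p < J → 0 < f p) :
    ∃ δ0 > 0, ∀ p, p < J → δ0 ≤ f p := by
  induction J with
  | zero => exact ⟨1, one_pos, fun p hp => absurd hp (by omega)⟩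
  | succ J ih =>
    obtain ⟨d, hd, h2⟩ := ih (fun p hp => h p (by omega))
    refine ⟨min d (f J), lt_min hd (h J (by omega)), fun p hp => ?_⟩
    rcases Nat.lt_succ_iff_lt_or_eq.1 hp with h3 | rfl
    · exact (min_le_left _ _).trans (h2 p h3)
    · exact min_le_right _ _

lemma geo_exists {I : ℕ} {l : ℝ} {aa bb : ℕ → ℝ} (h : SchwarzPartition I l aa bb) :
    ∃ δ0, Geo I l δ0 aa bb := by
  obtain ⟨hI, hl, ha1, hbI, haa, hab, hbb, -⟩ := h
  obtain ⟨δ0, hδ, hδ2⟩ := exists_gap (fun p => if 1 ≤ p then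
    min (aa (p + 1) - aa p) (min (bb p - aa (p + 1)) (bb (p + 1) - bb p)) else 1) I (by
      intro p hp
      by_cases h1 : 1 ≤ p
      · simp only [h1, if_true]
        exact lt_min (sub_pos.2 (haa p h1 hp)) (lt_min (sub_pos.2 (hab p h1 hp))
          (sub_pos.2 (hbb p h1 hp)))
      · simp [h1])
  have hage : ∀ p, 1 ≤ p → p ≤ I → -l ≤ aa p := by
    intro p h1
    induction p, h1 using Nat.le_induction with
    | base => intro _; exact ha1.ge
    | succ p h1 ih => intro h2; linarith [ih (by omega), haa p h1 (by omega)]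
  have hble : ∀ k p, 1 ≤ p → p + k = I → bb p ≤ l := by
    intro k
    induction k with
    | zero => intro p h1 h2; simp at h2; rw [h2, hbI]
    | succ k ih =>
      intro p h1 h2
      linarith [ih (p + 1) (by omega) (by omega), hbb p h1 (by omega)]
  have hs : ∀ p, 1 ≤ p → p < I → δ0 ≤ aa (p + 1) - aa p ∧ δ0 ≤ bb p - aa (p + 1) ∧
      δ0 ≤ bb (p + 1) - bb p := by
    intro p h1 h2
    have := hδ2 p h2
    simpa only [h1, if_true, le_min_iff] using this
  refine ⟨δ0, hδ, hl, ?_, hage, fun p h1 h2 => hble (I - p) p h1 (by omega), ha1, hbI, ?_, ?_, ?_⟩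
  · intro p h1 h2
    rcases Nat.lt_or_ge p I with h3 | h3
    · linarith [haa p h1 h3, hab p h1 h3]
    · obtain rfl : p = I := by omega
      rcases Nat.lt_or_ge 1 p with h4 | h4
      · obtain ⟨r, rfl⟩ : ∃ r, p = r + 1 := ⟨p - 1, by omega⟩
        linarith [hab r (by omega) (by omega), hbb r (by omega) (by omega)]
      · obtain rfl : p = 1 := by omega
        linarith
  · intro p h1 h2; linarith [(hs p h1 h2).1]
  · intro p h1 h2; linarith [(hs p h1 h2).2.1]
  · intro p h1 h2; linarith [(hs p h1 h2).2.2]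

lemma Geo.left {I : ℕ} {l δ0 : ℝ} {aa bb : ℕ → ℝ} (G : Geo I l δ0 aa bb) {p : ℕ} (h1 : 1 ≤ p)
    (h2 : p ≤ I) (h3 : p ≠ 1) : 1 ≤ p - 1 ∧ p - 1 ≤ I ∧ aa (p - 1) + δ0 ≤ aa p ∧
      aa p + δ0 ≤ bb (p - 1) ∧ bb (p - 1) + δ0 ≤ bb p := by
  obtain ⟨r, rfl⟩ : ∃ r, p = r + 1 := ⟨p - 1, by omega⟩
  have h4 : 1 ≤ r := by omega
  simp only [Nat.add_sub_cancel]
  exact ⟨h4, by omega, G.aa_step r h4 (by omega), G.ab_step r h4 (by omega),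
    G.bb_step r h4 (by omega)⟩

lemma Geo.right {I : ℕ} {l δ0 : ℝ} {aa bb : ℕ → ℝ} (G : Geo I l δ0 aa bb) {p : ℕ} (h1 : 1 ≤ p)
    (h2 : p ≤ I) (h3 : p ≠ I) : 1 ≤ p + 1 ∧ p + 1 ≤ I ∧ aa p + δ0 ≤ aa (p + 1) ∧
      aa (p + 1) + δ0 ≤ bb p ∧ bb p + δ0 ≤ bb (p + 1) :=
  ⟨by omega, by omega, G.aa_step p h1 (by omega), G.ab_step p h1 (by omega),
    G.bb_step p h1 (by omega)⟩

lemma Geo.mem {I : ℕ} {l δ0 : ℝ} {aa bb : ℕ → ℝ} (G : Geo I l δ0 aa bb) {n p : ℕ} (h1 : 1 ≤ p)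
    (h2 : p ≤ I) (x : ES (n + 1)) : x ∈ closure (Subdom (n := n) l (aa p) (bb p)) ↔
      (∀ i, i ≠ Fin.last n → x i ∈ Icc (-l) l) ∧ x (Fin.last n) ∈ Icc (aa p) (bb p) :=
  closure_subdom G.hl (G.lt p h1 h2) x

lemma Geo.coord {I : ℕ} {l δ0 : ℝ} {aa bb : ℕ → ℝ} (G : Geo I l δ0 aa bb) {n p : ℕ} (h1 : 1 ≤ p)
    (h2 : p ≤ I) {x : ES (n + 1)} (hx : x ∈ closure (Subdom (n := n) l (aa p) (bb p)))
    (i : Fin (n + 1)) : x i ∈ Icc (-l) l := by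
  rw [G.mem h1 h2] at hx
  by_cases hi : i = Fin.last n
  · subst hi
    exact ⟨(G.a_ge p h1 h2).trans hx.2.1, hx.2.2.trans (G.b_le p h1 h2)⟩
  · exact hx.1 i hi

/-- Boundary trichotomy on a subdomain. -/
lemma Geo.bdry {I : ℕ} {l δ0 : ℝ} {aa bb : ℕ → ℝ} (G : Geo I l δ0 aa bb) {n p : ℕ} (h1 : 1 ≤ p)
    (h2 : p ≤ I) {x : ES (n + 1)} (hx : x ∈ closure (Subdom (n := n) l (aa p) (bb p)))
    (hx' : x ∉ Subdom (n := n) l (aa p) (bb p)) :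
    (∃ i : Fin (n + 1), i ≠ Fin.last n ∧ (x i = l ∨ x i = -l)) ∨ x (Fin.last n) = aa p ∨
      x (Fin.last n) = bb p := by
  rw [G.mem h1 h2] at hx
  by_contra hcon
  push Not at hcon
  obtain ⟨hc1, hc2, hc3⟩ := hcon
  apply hx'
  refine ⟨fun i hi => ?_, lt_of_le_of_ne hx.2.1 hc2.symm, lt_of_le_of_ne hx.2.2 hc3⟩
  exact ⟨lt_of_le_of_ne (hx.1 i hi).1 (hc1 i hi).2.symm, lt_of_le_of_ne (hx.1 i hi).2 (hc1 i hi).1⟩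

/-- Boundary data of the iterates. -/
lemma bdry_data {n m I : ℕ} {T l δ0 : ℝ} {aa bb : ℕ → ℝ} (G : Geo I l δ0 aa bb)
    {a : ℝ → ES (n + 1) → ES m → Matrix (Fin (n + 1)) (Fin (n + 1)) ℝ}
    {b : ℝ → ES (n + 1) → ES m → ES (n + 1)} {bh : ℝ → ES (n + 1) → ES m → ES m}
    {g θ0 : ES (n + 1) → ES m} {Θ : ℕ → ℕ → ℝ → ES (n + 1) → ES m}
    (hΘ : SchwarzIterates T l I aa bb a b bh g θ0 Θ) {p q : ℕ} (h1 : 1 ≤ p) (h2 : p ≤ I)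
    (hq : 1 ≤ q) {t : ℝ} (ht : t ∈ Icc 0 T) {x : ES (n + 1)}
    (hx : x ∈ closure (Subdom (n := n) l (aa p) (bb p)))
    (hx' : ¬ (t < T ∧ x ∈ Subdom (n := n) l (aa p) (bb p))) :
    (Θ p q t x = g x ∧ (t = T ∨ ∃ i, x i = l ∨ x i = -l)) ∨
    (p ≠ 1 ∧ x (Fin.last n) = aa p ∧ Θ p q t x = Θ (p - 1) (q - 1) t x ∧
      x ∈ closure (Subdom (n := n) l (aa (p - 1)) (bb (p - 1)))) ∨
    (p ≠ I ∧ x (Fin.last n) = bb p ∧ Θ p q t x = Θ (p + 1) (q - 1) t x ∧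
      x ∈ closure (Subdom (n := n) l (aa (p + 1)) (bb (p + 1)))) := by
  obtain ⟨-, -, h3, h4⟩ := hΘ.2 p ⟨h1, h2⟩ q hq
  by_cases htT : t < T
  · have hxn : x ∉ Subdom (n := n) l (aa p) (bb p) := fun h => hx' ⟨htT, h⟩
    obtain ⟨ha, hb, hlat⟩ := h3 t ht x hx
    have hx2 := (G.mem h1 h2 x).1 hx
    rcases G.bdry h1 h2 hx hxn with h | h | h
    · exact Or.inl ⟨hlat h, Or.inr (by obtain ⟨i, -, hi⟩ := h; exact ⟨i, hi⟩)⟩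
    · have ha2 := ha h
      by_cases hp : p = 1
      · simp only [hp, if_true] at ha2
        left
        rw [hp] at h
        rw [G.a1] at h
        refine ⟨by rw [hp]; exact ha2, Or.inr ⟨Fin.last n, Or.inr h⟩⟩
      · simp only [hp, if_false] at ha2
        right; left
        obtain ⟨k1, k2, k3, k4, k5⟩ := G.left h1 h2 hp
        refine ⟨hp, h, ha2, (G.mem k1 k2 x).2 ⟨hx2.1, ?_, ?_⟩⟩ <;> linarith [G.pos]
    · have hb2 := hb h
      by_cases hp : p = I
      · simp only [hp, if_true] at hb2
        left
        rw [hp] at h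
        rw [G.bI] at h
        refine ⟨by rw [hp]; exact hb2, Or.inr ⟨Fin.last n, Or.inl h⟩⟩
      · simp only [hp, if_false] at hb2
        right; right
        obtain ⟨k1, k2, k3, k4, k5⟩ := G.right h1 h2 hp
        refine ⟨hp, h, hb2, (G.mem k1 k2 x).2 ⟨hx2.1, ?_, ?_⟩⟩ <;> linarith [G.pos]
  · left
    have : t = T := le_antisymm ht.2 (not_lt.1 htT)
    subst this
    exact ⟨h4 x hx, Or.inl rfl⟩

/-! ### Uniform boundary barrier for the iterates -/

lemma exp_tangent (s : ℝ) : s * Real.exp (-s) ≤ 1 - Real.exp (-s) := by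
  have h1 := Real.add_one_le_exp s
  have h2 := Real.exp_pos (-s)
  have h3 : Real.exp s * Real.exp (-s) = 1 := by rw [← Real.exp_add]; simp
  nlinarith

/-- replace one coordinate -/
def updC {n : ℕ} (x : ES n) (i : Fin n) (c : ℝ) : ES n := x + EuclideanSpace.single i (c - x i)

lemma updC_same {n : ℕ} (x : ES n) (i : Fin n) (c : ℝ) : updC x i c i = c := by
  simp [updC]

lemma updC_ne {n : ℕ} (x : ES n) {i j : Fin n} (h : j ≠ i) (c : ℝ) : updC x i c j = x j := by
  simp [updC, h]

lemma updC_dist {n : ℕ} (x : ES n) (i : Fin n) (c : ℝ) : ‖x - updC x i c‖ = |c - x i| := by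
  simp [updC]

lemma barrier_all {n m d I : ℕ} {T l δ0 M₀ : ℝ} {aa bb : ℕ → ℝ} (G : Geo I l δ0 aa bb)
    {σ : ℝ → ES (n + 1) → ES m → Matrix (Fin (n + 1)) (Fin d) ℝ}
    {b : ℝ → ES (n + 1) → ES m → ES (n + 1)} {bh : ℝ → ES (n + 1) → ES m → ES m}
    {g θ0 : ES (n + 1) → ES m} {Θ : ℕ → ℕ → ℝ → ES (n + 1) → ES m}
    (hΘ : SchwarzIterates T l I aa bb (halfSigmaSigmaT σ) b bh g θ0 Θ)
    (hΘbdd : ∀ p ∈ Icc 1 I, ∀ q : ℕ, ∀ t ∈ Icc (0 : ℝ) T,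
      ∀ x ∈ closure (Subdom l (aa p) (bb p)), ‖Θ p q t x‖ ≤ M₀)
    (hgbdd : ∀ x, ‖g x‖ ≤ M₀)
    (hg : ContDiff ℝ 2 g) {Kg : ℝ} (hg1 : ∀ x, ‖fderiv ℝ g x‖ ≤ Kg)
    (hg2 : ∀ x, ‖fderiv ℝ (fderiv ℝ g) x‖ ≤ Kg)
    {Lg L0 : ℝ} (hLg : ∀ x y, ‖g x - g y‖ ≤ Lg * ‖x - y‖)
    (hL0 : ∀ x ∈ BoxC (n := n + 1) (fun _ => -l) (fun _ => l),
      ∀ y ∈ BoxC (n := n + 1) (fun _ => -l) (fun _ => l), ‖θ0 x - θ0 y‖ ≤ L0 * ‖x - y‖)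
    {ν0 S B H : ℝ} (hν0 : 0 < ν0) (hB : 0 ≤ B)
    (ellip : ∀ t ∈ Ioo 0 T, ∀ x w, ‖w‖ ≤ M₀ → ∀ i, ν0 ≤ ∑ c, σ t x w i c ^ 2)
    (bσ : ∀ t ∈ Ioo 0 T, ∀ x w i c, |σ t x w i c| ≤ S)
    (bb' : ∀ t ∈ Ioo 0 T, ∀ x w, ‖w‖ ≤ M₀ → ‖b t x w‖ ≤ B)
    (bbh : ∀ t ∈ Ioo 0 T, ∀ x w, ‖w‖ ≤ M₀ → ‖bh t x w‖ ≤ H) :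
    ∃ CB, 0 ≤ CB ∧ ∀ q, 1 ≤ q → ∀ p, 1 ≤ p → p ≤ I → ∀ t ∈ Ioc 0 T,
      ∀ x ∈ closure (Subdom (n := n) l (aa p) (bb p)), ∀ i, ∀ e : ℝ, (e = 1 ∨ e = -1) →
        ‖Θ p q t x - g x‖ ≤ CB * (l - e * x i) := by
  have hl := G.hl
  have hM0 : 0 ≤ M₀ := (norm_nonneg _).trans (hgbdd 0)
  obtain ⟨γ, hγ, hγ1⟩ : ∃ γ : ℝ, 0 < γ ∧ 1 ≤ 2⁻¹ * γ ^ 2 * ν0 - γ * B := by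
    have h1 : 0 < 2 * (B + 1) / ν0 := by positivity
    refine ⟨2 * (B + 1) / ν0 + 1, by linarith, ?_⟩
    have h2 : 2 * (B + 1) / ν0 * ν0 = 2 * (B + 1) := by field_simp
    set r := 2 * (B + 1) / ν0
    have : 2⁻¹ * (r + 1) ^ 2 * ν0 = 2⁻¹ * (r + 1) * (r * ν0 + ν0) := by ring
    rw [this, h2]
    nlinarith
  have hE : 0 < Real.exp (-γ * (2 * l)) := Real.exp_pos _
  have hF : 0 < 1 - Real.exp (-γ * δ0) := by
    have : Real.exp (-γ * δ0) < 1 := by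
      rw [Real.exp_lt_one_iff]
      nlinarith [G.pos]
    linarith
  obtain ⟨N, hN, hN1, hN2, hN3⟩ : ∃ N : ℝ, 0 ≤ N ∧
      H + Kg * (2⁻¹ * d * (n + 1 : ℕ) * S ^ 2) + Kg * B < N * Real.exp (-γ * (2 * l)) ∧
      L0 + Lg ≤ N * (γ * Real.exp (-γ * (2 * l))) ∧ 2 * M₀ ≤ N * (1 - Real.exp (-γ * δ0)) := by
    have key : ∀ A D : ℝ, 0 < D → ∃ N0, 0 ≤ N0 ∧ ∀ N ≥ N0, A < N * D := by
      intro A D hD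
      refine ⟨(|A| + 1) / D, by positivity, fun N hN => ?_⟩
      have : (|A| + 1) / D * D = |A| + 1 := by field_simp
      nlinarith [le_abs_self A]
    obtain ⟨N1, hp1, h1⟩ := key (H + Kg * (2⁻¹ * d * (n + 1 : ℕ) * S ^ 2) + Kg * B) _ hE
    obtain ⟨N2, hp2, h2⟩ := key (L0 + Lg) _ (mul_pos hγ hE)
    obtain ⟨N3, hp3, h3⟩ := key (2 * M₀) _ hF
    exact ⟨N1 + N2 + N3, by positivity, h1 _ (by linarith), (h2 _ (by linarith)).le,
      (h3 _ (by linarith)).le⟩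
  have hnon : ∀ {x : ES (n + 1)} {i : Fin (n + 1)} {e : ℝ}, x i ∈ Icc (-l) l → (e = 1 ∨ e = -1) →
      0 ≤ l - e * x i ∧ l - e * x i ≤ 2 * l := by
    intro x i e hx he
    rcases he with rfl | rfl <;> constructor <;> linarith [hx.1, hx.2]
  have hψ : ∀ {s : ℝ}, 0 ≤ s → 0 ≤ N * (1 - Real.exp (-γ * s)) := by
    intro s hs
    have : Real.exp (-γ * s) ≤ 1 := by
      rw [Real.exp_le_one_iff]; nlinarith
    exact mul_nonneg hN (by linarith)
  have hsgk : ∀ {sg : ℝ} (w : ES m) (k : Fin m), (sg = 1 ∨ sg = -1) → sg * w k ≤ ‖w‖ := by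
    intro sg w k hsg
    refine le_trans ?_ (abs_coord_le w k)
    rcases hsg with rfl | rfl
    · simpa using le_abs_self _
    · simpa using neg_le_abs _
  -- base estimate at the interfaces
  have hbase : ∀ {t : ℝ}, t ∈ Icc 0 T → ∀ {p r : ℕ}, 1 ≤ p → p ≤ I → 1 ≤ r → r ≤ I →
      ∀ x ∈ closure (Subdom (n := n) l (aa p) (bb p)),
      x ∈ closure (Subdom (n := n) l (aa r) (bb r)) →
      (∀ x' ∈ closure (Subdom (n := n) l (aa p) (bb p)), x' (Fin.last n) = x (Fin.last n) →
        Θ p 1 t x' = Θ r 0 t x') → ∀ i, i ≠ Fin.last n → ∀ e : ℝ, (e = 1 ∨ e = -1) →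
      ‖Θ r 0 t x - g x‖ ≤ N * (1 - Real.exp (-γ * (l - e * x i))) := by
    intro t ht p r h1 h2 r1 r2 x hx hxr hinn i hi e he
    have hxi := G.coord h1 h2 hx i
    obtain ⟨hd0, hd1⟩ := hnon hxi he
    set x' := updC x i (e * l) with hx'
    have hlast : x' (Fin.last n) = x (Fin.last n) := updC_ne x (Ne.symm hi) _
    have hel : e * l ∈ Icc (-l) l := by
      rcases he with rfl | rfl <;> constructor <;> linarith
    have hmem : ∀ {s : ℕ}, 1 ≤ s → s ≤ I → x ∈ closure (Subdom (n := n) l (aa s) (bb s)) →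
        x' ∈ closure (Subdom (n := n) l (aa s) (bb s)) := by
      intro s s1 s2 hs
      rw [G.mem s1 s2] at hs ⊢
      refine ⟨fun j hj => ?_, by rw [hlast]; exact hs.2⟩
      by_cases hji : j = i
      · subst hji; rw [hx', updC_same]; exact hel
      · rw [hx', updC_ne _ hji]; exact hs.1 j hj
    have hp' := hmem h1 h2 hx
    have hr' := hmem r1 r2 hxr
    have e1 : Θ p 1 t x' = g x' := by
      apply ((hΘ.2 p ⟨h1, h2⟩ 1 le_rfl).2.2.1 t ht x' hp').2.2
      refine ⟨i, hi, ?_⟩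
      rw [hx', updC_same]
      rcases he with rfl | rfl
      · left; ring
      · right; ring
    have e2 : θ0 x' = g x' := by
      rw [← hΘ.1 r ⟨r1, r2⟩ t ht x' hr', ← hinn x' hp' hlast, e1]
    rw [hΘ.1 r ⟨r1, r2⟩ t ht x hxr]
    have e3 : ‖x - x'‖ = l - e * x i := by
      rw [hx', updC_dist]
      rcases he with rfl | rfl
      · rw [abs_of_nonneg] <;> linarith
      · rw [abs_of_nonpos] <;> linarith
    have e4 : ‖θ0 x - g x‖ ≤ (L0 + Lg) * (l - e * x i) := by
      have a1 := hL0 x (fun j => G.coord h1 h2 hx j) x' (fun j => G.coord h1 h2 hp' j)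
      have a2 := hLg x' x
      rw [norm_sub_rev x' x, e3] at a2
      rw [e3] at a1
      calc ‖θ0 x - g x‖ = ‖(θ0 x - θ0 x') + (g x' - g x)‖ := by rw [e2]; congr 1; abel
        _ ≤ _ := (norm_add_le _ _).trans (by linarith)
    refine e4.trans ?_
    have e5 : (L0 + Lg) * (l - e * x i) ≤ N * (γ * Real.exp (-γ * (2 * l))) * (l - e * x i) :=
      mul_le_mul_of_nonneg_right hN2 hd0
    have e6 := exp_tangent (γ * (l - e * x i))
    have e7 : Real.exp (-γ * (2 * l)) ≤ Real.exp (-(γ * (l - e * x i))) :=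
      Real.exp_le_exp.2 (by nlinarith)
    have e8 : γ * (l - e * x i) * Real.exp (-γ * (2 * l)) ≤ 1 - Real.exp (-γ * (l - e * x i)) := by
      rw [neg_mul γ (l - e * x i)]
      exact (mul_le_mul_of_nonneg_left e7 (mul_nonneg hγ.le hd0)).trans e6
    calc _ ≤ _ := e5
      _ = N * (γ * (l - e * x i) * Real.exp (-γ * (2 * l))) := by ring
      _ ≤ _ := mul_le_mul_of_nonneg_left e8 hN
  -- induction
  have main : ∀ q, 1 ≤ q → ∀ p, 1 ≤ p → p ≤ I → ∀ (k : Fin m) (i : Fin (n + 1)) (sg e : ℝ),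
      (sg = 1 ∨ sg = -1) → (e = 1 ∨ e = -1) → ∀ t ∈ Ioc 0 T,
      ∀ x ∈ closure (Subdom (n := n) l (aa p) (bb p)),
      sg * (Θ p q t x k - g x k) ≤ N * (1 - Real.exp (-γ * (l - e * x i))) := by
    intro q
    induction q with
    | zero => intro h; omega
    | succ q ih =>
      intro _ p h1 h2 k i sg e hsg he
      have hsol := (hΘ.2 p ⟨h1, h2⟩ (q + 1) (by omega)).1
      have hQ : IsOpen (Subdom (n := n) l (aa p) (bb p)) := by
        rw [subdom_eq]; exact isOpen_BoxO _ _
      have hwb : ∀ t ∈ Ioo 0 T, ∀ x ∈ Subdom (n := n) l (aa p) (bb p), ‖Θ p (q + 1) t x‖ ≤ M₀ :=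
        fun t ht x hx => hΘbdd p ⟨h1, h2⟩ _ t ⟨ht.1.le, ht.2.le⟩ x (subset_closure hx)
      refine barrier_comparison σ b bh hQ (isCompact_closure_subdom hl (G.lt p h1 h2)) hsol hg hg1
        hg2 k i hsg he hγ hN
        (fun x hx => (hnon (G.coord h1 h2 (subset_closure hx) i) he).2)
        (fun t ht x hx => ellip t ht x _ (hwb t ht x hx) i)
        (fun t ht x hx => bσ t ht x _)
        (fun t ht x hx => bb' t ht x _ (hwb t ht x hx))
        (fun t ht x hx => bbh t ht x _ (hwb t ht x hx)) hγ1 hN1 ?_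
      intro t ht x hx hx'
      have ht' : t ∈ Icc 0 T := ⟨ht.1.le, ht.2⟩
      have hd0 := (hnon (G.coord h1 h2 hx i) he).1
      have hsg2 : sg * (Θ p (q + 1) t x k - g x k) ≤ ‖Θ p (q + 1) t x - g x‖ :=
        hsgk (Θ p (q + 1) t x - g x) k hsg
      have hfar : δ0 ≤ l - e * x i →
          sg * (Θ p (q + 1) t x k - g x k) ≤ N * (1 - Real.exp (-γ * (l - e * x i))) := by
        intro hfar
        refine hsg2.trans ((norm_sub_le _ _).trans ?_)
        have a1 := hΘbdd p ⟨h1, h2⟩ (q + 1) t ht' x hx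
        have a2 := hgbdd x
        have a3 : Real.exp (-γ * (l - e * x i)) ≤ Real.exp (-γ * δ0) :=
          Real.exp_le_exp.2 (by nlinarith)
        have a4 : N * (1 - Real.exp (-γ * δ0)) ≤ N * (1 - Real.exp (-γ * (l - e * x i))) :=
          mul_le_mul_of_nonneg_left (by linarith) hN
        linarith
      rcases bdry_data G hΘ h1 h2 (q := q + 1) (by omega) ht' hx hx' with
        ⟨h, -⟩ | ⟨hp, hxl, heq, hxr⟩ | ⟨hp, hxl, heq, hxr⟩
      · rw [h]
        simpa using hψ hd0
      · obtain ⟨k1, k2, k3, k4, k5⟩ := G.left h1 h2 hp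
        by_cases hi : i = Fin.last n
        · apply hfar
          have c1 := G.a_ge (p - 1) k1 k2
          have c2 := G.b_le p h1 h2
          rw [hi, hxl]
          have := G.pos
          rcases he with rfl | rfl <;> linarith
        · simp only [Nat.add_sub_cancel] at heq
          by_cases hq0 : q = 0
          · subst hq0
            refine hsg2.trans ?_
            rw [heq]
            refine hbase ht' h1 h2 k1 k2 x hx hxr ?_ i hi e he
            intro x' hx2 hx3
            have := ((hΘ.2 p ⟨h1, h2⟩ 1 le_rfl).2.2.1 t ht' x' hx2).1 (hx3.trans hxl)
            simpa [hp] using this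
          · rw [heq]
            exact ih (by omega) (p - 1) k1 k2 k i sg e hsg he t ht x hxr
      · obtain ⟨k1, k2, k3, k4, k5⟩ := G.right h1 h2 hp
        by_cases hi : i = Fin.last n
        · apply hfar
          have c1 := G.a_ge p h1 h2
          have c2 := G.b_le (p + 1) k1 k2
          rw [hi, hxl]
          have := G.pos
          rcases he with rfl | rfl <;> linarith
        · simp only [Nat.add_sub_cancel] at heq
          by_cases hq0 : q = 0
          · subst hq0
            refine hsg2.trans ?_
            rw [heq]
            refine hbase ht' h1 h2 k1 k2 x hx hxr ?_ i hi e he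
            intro x' hx2 hx3
            have := ((hΘ.2 p ⟨h1, h2⟩ 1 le_rfl).2.2.1 t ht' x' hx2).2.1 (hx3.trans hxl)
            simpa [hp] using this
          · rw [heq]
            exact ih (by omega) (p + 1) k1 k2 k i sg e hsg he t ht x hxr
  refine ⟨m * (N * γ), by positivity, ?_⟩
  intro q hq p h1 h2 t ht x hx i e he
  rw [mul_assoc]
  apply norm_le_of_coord
  intro k
  have hb : ∀ sg : ℝ, (sg = 1 ∨ sg = -1) →
      sg * (Θ p q t x k - g x k) ≤ N * γ * (l - e * x i) := by
    intro sg hsg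
    refine (main q hq p h1 h2 k i sg e hsg he t ht x hx).trans ?_
    rw [mul_assoc]
    refine mul_le_mul_of_nonneg_left ?_ hN
    have := Real.add_one_le_exp (-γ * (l - e * x i))
    linarith
  have c1 := hb 1 (Or.inl rfl)
  have c2 := hb (-1) (Or.inr rfl)
  have c3 : (Θ p q t x - g x) k = Θ p q t x k - g x k := rfl
  rw [c3, abs_le]
  constructor <;> linarith

/-! ### The contraction argument -/

lemma phi_nonpos {n m : ℕ} {A : ES m} {D : ES n} {c K r M : ℝ} (hA : ‖A‖ ≤ c * ‖D‖) (hc : c ^ 2 ≤ K)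
    (hM : 0 ≤ M) : Real.exp r * (‖A‖ ^ 2 - K * ‖D‖ ^ 2) ≤ M := by
  have h1 : ‖A‖ ^ 2 ≤ (c * ‖D‖) ^ 2 := pow_le_pow_left₀ (norm_nonneg _) hA 2
  have h2 : c ^ 2 * ‖D‖ ^ 2 ≤ K * ‖D‖ ^ 2 := mul_le_mul_of_nonneg_right hc (sq_nonneg _)
  have h3 : ‖A‖ ^ 2 - K * ‖D‖ ^ 2 ≤ 0 := by nlinarith
  have := Real.exp_pos r
  nlinarith

set_option maxHeartbeats 2000000 in
lemma contraction {n m d I : ℕ} {T l δ0 M₀ : ℝ} {aa bb : ℕ → ℝ} (G : Geo I l δ0 aa bb)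
    {σ : ℝ → ES (n + 1) → ES m → Matrix (Fin (n + 1)) (Fin d) ℝ}
    {b : ℝ → ES (n + 1) → ES m → ES (n + 1)} {bh : ℝ → ES (n + 1) → ES m → ES m}
    {g θ0 : ES (n + 1) → ES m} {Θ : ℕ → ℕ → ℝ → ES (n + 1) → ES m}
    (hΘ : SchwarzIterates T l I aa bb (halfSigmaSigmaT σ) b bh g θ0 Θ)
    (hΘbdd : ∀ p ∈ Icc 1 I, ∀ q : ℕ, ∀ t ∈ Icc (0 : ℝ) T,
      ∀ x ∈ closure (Subdom l (aa p) (bb p)), ‖Θ p q t x‖ ≤ M₀)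
    {θl : ℝ → ES (n + 1) → ES m}
    (hθl : IsCubeSolution T l (halfSigmaSigmaT σ) b bh g θl)
    {Lg L S B CB : ℝ} (hLg0 : 0 ≤ Lg) (hLg : ∀ x y, ‖g x - g y‖ ≤ Lg * ‖x - y‖)
    (hL : 0 ≤ L) (hB : 0 ≤ B) (hCB : 0 ≤ CB)
    (lbh : ∀ t x y w w', ‖bh t x w - bh t y w'‖ ≤ L * (‖x - y‖ + ‖w - w'‖))
    (lb : ∀ t x y w w', ‖b t x w - b t y w'‖ ≤ L * (‖x - y‖ + ‖w - w'‖))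
    (lσ : ∀ t x y w w' i c, |σ t x w i c - σ t y w' i c| ≤ L * (‖x - y‖ + ‖w - w'‖))
    (bσ : ∀ t ∈ Ioo 0 T, ∀ x w i c, |σ t x w i c| ≤ S)
    (bb' : ∀ t ∈ Ioo 0 T, ∀ x w, ‖w‖ ≤ M₀ → ‖b t x w‖ ≤ B)
    (barr : ∀ q, 1 ≤ q → ∀ p, 1 ≤ p → p ≤ I → ∀ t ∈ Ioc 0 T,
      ∀ x ∈ closure (Subdom (n := n) l (aa p) (bb p)), ∀ i, ∀ e : ℝ, (e = 1 ∨ e = -1) →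
        ‖Θ p q t x - g x‖ ≤ CB * (l - e * x i)) :
    ∃ D, 0 ≤ D ∧ ∀ q p, 1 ≤ p → p ≤ I → ∀ t ∈ Ioc 0 T,
      ∀ x ∈ closure (Subdom (n := n) l (aa p) (bb p)),
        ‖Θ p (q + 1) t x - θl t x‖ ^ 2 ≤ D * (1 / 2) ^ q := by
  have hl := G.hl
  obtain ⟨hv, hvb, hvT, hvd⟩ := hθl
  obtain ⟨Lv, hLv0, hLv⟩ := sol_lipschitz hl hv hvd
  obtain ⟨M1, hM1⟩ := (isCompact_Icc.prod (isCompact_closure_cube (n := n) hl)).exists_bound_of_continuousOn hv.1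
  have hOpen : IsOpen (OpenCube (n := n) l) := by rw [cube_eq]; exact isOpen_BoxO _ _
  obtain ⟨K, hK1, hK2, hK3, hK4, hK5⟩ : ∃ K : ℝ, 1 ≤ K ∧ 8 * Lv ^ 2 ≤ K ∧ Lv ^ 2 ≤ K ∧
      (CB + Lg) ^ 2 ≤ K ∧ Lg ^ 2 ≤ K := by
    refine ⟨1 + 8 * Lv ^ 2 + (CB + Lg) ^ 2, ?_, ?_, ?_, ?_, ?_⟩ <;>
      nlinarith [sq_nonneg Lv, sq_nonneg (CB + Lg), mul_nonneg hCB hLg0, sq_nonneg CB]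
  obtain ⟨κ, hκ, hκδ⟩ : ∃ κ : ℝ, 0 ≤ κ ∧ Real.exp (-κ * δ0) ≤ 1 / 4 := by
    have := G.pos
    refine ⟨4 / δ0, by positivity, ?_⟩
    have h1 : -(4 / δ0) * δ0 = -4 := by field_simp
    have h2 := Real.add_one_le_exp (4 : ℝ)
    have h3 : Real.exp 4 * Real.exp (-4) = 1 := by rw [← Real.exp_add]; simp
    have h4 := Real.exp_pos (-4 : ℝ)
    rw [h1]
    nlinarith
  obtain ⟨lm, hlm⟩ := exists_gt (2 * (4 * L + K * (4 * d * (n + 1 : ℕ) * L ^ 2 + 4 * L)) +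
    (2⁻¹ * d * κ ^ 2 * S ^ 2 + κ * B))
  have hlm0 : 0 ≤ lm := by
    refine le_trans ?_ hlm.le
    positivity
  set Φ : ℕ → ℕ → ℝ → ES (n + 1) → ES (n + 1) → ℝ := fun p q t x y =>
    Real.exp (lm * t) * (‖Θ p q t x - θl t y‖ ^ 2 - K * ‖x - y‖ ^ 2) with hΦ
  -- one step
  have step : ∀ (q : ℕ) (M : ℝ), 0 ≤ M →
      (∀ p, 1 ≤ p → p ≤ I → ∀ t ∈ Ioc 0 T, ∀ x ∈ closure (Subdom (n := n) l (aa p) (bb p)),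
        ∀ y ∈ closure (OpenCube (n := n) l), ((p ≠ 1 ∧ x (Fin.last n) = bb (p - 1)) ∨
          (p ≠ I ∧ x (Fin.last n) = aa (p + 1))) → Φ p q t x y ≤ M) →
      ∀ p, 1 ≤ p → p ≤ I → ∀ t ∈ Ioc 0 T, ∀ x ∈ closure (Subdom (n := n) l (aa p) (bb p)),
        ∀ y ∈ closure (OpenCube (n := n) l), Φ p (q + 1) t x y ≤
          M * (Real.exp (-κ * (x (Fin.last n) - aa p)) + Real.exp (κ * (x (Fin.last n) - bb p))) := by
    intro q M hM hyp p h1 h2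
    have hsol := (hΘ.2 p ⟨h1, h2⟩ (q + 1) (by omega)).1
    have hQ : IsOpen (Subdom (n := n) l (aa p) (bb p)) := by
      rw [subdom_eq]; exact isOpen_BoxO _ _
    have hwb : ∀ t ∈ Ioo 0 T, ∀ x ∈ Subdom (n := n) l (aa p) (bb p), ‖Θ p (q + 1) t x‖ ≤ M₀ :=
      fun t ht x hx => hΘbdd p ⟨h1, h2⟩ _ t ⟨ht.1.le, ht.2.le⟩ x (subset_closure hx)
    have hQO : Subdom (n := n) l (aa p) (bb p) ⊆ OpenCube l := by
      intro x hx i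
      by_cases hi : i = Fin.last n
      · subst hi
        exact ⟨(G.a_ge p h1 h2).trans_lt hx.2.1, hx.2.2.trans_le (G.b_le p h1 h2)⟩
      · exact hx.1 i hi
    refine doubled_comparison σ b bh hQ hOpen hQO (isCompact_closure_subdom hl (G.lt p h1 h2))
      (isCompact_closure_cube hl) hsol hv (Fin.last n) hL hLv0 hM hκ hK1 hK2 lbh lb lσ
      (fun t ht x _ c => bσ t ht x _ _ c)
      (fun t ht x hx => (abs_coord_le _ _).trans (bb' t ht x _ (hwb t ht x hx))) hLv hlm ?_
    intro t ht x hx y hy hnot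
    have ht' : t ∈ Icc 0 T := ⟨ht.1.le, ht.2⟩
    have hR : 0 ≤ M * (Real.exp (-κ * (x (Fin.last n) - aa p)) +
        Real.exp (κ * (x (Fin.last n) - bb p))) := by positivity
    have hxc : x ∈ closure (OpenCube (n := n) l) := closure_mono hQO hx
    by_cases htT : t < T
    swap
    · have : t = T := le_antisymm ht.2 (not_lt.1 htT)
      subst this
      rw [(hΘ.2 p ⟨h1, h2⟩ (q + 1) (by omega)).2.2.2 x hx, hvT y hy]
      exact phi_nonpos (hLg x y) hK5 hR
    have htIoo : t ∈ Ioo 0 T := ⟨ht.1, htT⟩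
    have hfr : ∀ z : ES (n + 1), z ∈ closure (OpenCube (n := n) l) → z ∉ OpenCube (n := n) l →
        z ∈ frontier (OpenCube (n := n) l) := by
      intro z h3 h4
      rw [frontier, hOpen.interior_eq]
      exact ⟨h3, h4⟩
    by_cases hyO : y ∈ OpenCube (n := n) l
    swap
    · rw [hvb t ht' y (hfr y hy hyO)]
      refine phi_nonpos (c := CB + Lg) ?_ hK4 hR
      have hy2 := (closure_cube hl y).1 hy
      obtain ⟨i, e, he, hyi⟩ : ∃ (i : Fin (n + 1)) (e : ℝ), (e = 1 ∨ e = -1) ∧ y i = e * l := by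
        by_contra hcon
        push Not at hcon
        apply hyO
        intro i
        have c1 := hcon i 1 (Or.inl rfl)
        have c2 := hcon i (-1) (Or.inr rfl)
        rw [one_mul] at c1
        rw [neg_one_mul] at c2
        exact ⟨lt_of_le_of_ne (hy2 i).1 c2.symm, lt_of_le_of_ne (hy2 i).2 c1⟩
      have c1 := barr (q + 1) (by omega) p h1 h2 t ht x hx i e he
      have c2 : l - e * x i ≤ ‖x - y‖ := by
        refine le_trans ?_ (abs_coord_le (x - y) i)
        have : (x - y) i = x i - y i := rfl
        rw [this, hyi]
        rcases he with rfl | rfl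
        · rw [abs_sub_comm]; refine le_trans ?_ (le_abs_self _); linarith
        · refine le_trans ?_ (le_abs_self _); linarith
      have c3 := hLg x y
      have c4 : CB * (l - e * x i) ≤ CB * ‖x - y‖ := mul_le_mul_of_nonneg_left c2 hCB
      calc ‖Θ p (q + 1) t x - g y‖ = ‖(Θ p (q + 1) t x - g x) + (g x - g y)‖ := by
            congr 1; abel
        _ ≤ _ := (norm_add_le _ _).trans (by linarith)
    have hxQ : ¬ (t < T ∧ x ∈ Subdom (n := n) l (aa p) (bb p)) := fun h => hnot ⟨h.1, h.2, hyO⟩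
    rcases bdry_data G hΘ h1 h2 (q := q + 1) (by omega) ht' hx hxQ with
        ⟨h, h'⟩ | ⟨hp, hxl, heq, hxr⟩ | ⟨hp, hxl, heq, hxr⟩
    · rcases h' with h' | ⟨i, hi⟩
      · exact absurd h' htT.ne
      have hxf : x ∈ frontier (OpenCube (n := n) l) := by
        apply hfr x hxc
        intro hxO
        have := hxO i
        rcases hi with hi | hi
        · linarith [this.2]
        · linarith [this.1]
      rw [h, ← hvb t ht' x hxf]
      exact phi_nonpos (hLv t htIoo x hxc y hy) hK3 hR
    · obtain ⟨k1, k2, k3, k4, k5⟩ := G.left h1 h2 hp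
      rw [heq]
      refine (hyp (p - 1) k1 k2 t ht x hxr y hy (Or.inr ⟨by omega, ?_⟩)).trans ?_
      · rw [hxl]; congr 1; omega
      · rw [hxl]
        have := Real.exp_pos (κ * (aa p - bb p))
        simp only [sub_self, mul_zero, Real.exp_zero]
        nlinarith
    · obtain ⟨k1, k2, k3, k4, k5⟩ := G.right h1 h2 hp
      rw [heq]
      refine (hyp (p + 1) k1 k2 t ht x hxr y hy (Or.inl ⟨by omega, ?_⟩)).trans ?_
      · rw [hxl]; congr 1
      · rw [hxl]
        have := Real.exp_pos (-κ * (bb p - aa p))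
        simp only [sub_self, mul_zero, Real.exp_zero]
        nlinarith
  -- iteration
  set D := Real.exp (lm * T) * (|M₀| + |M1|) ^ 2 with hD
  have hD0 : 0 ≤ D := by positivity
  have iter : ∀ q : ℕ, ∀ p, 1 ≤ p → p ≤ I → ∀ t ∈ Ioc 0 T,
      ∀ x ∈ closure (Subdom (n := n) l (aa p) (bb p)),
      ∀ y ∈ closure (OpenCube (n := n) l), ((p ≠ 1 ∧ x (Fin.last n) = bb (p - 1)) ∨
          (p ≠ I ∧ x (Fin.last n) = aa (p + 1))) → Φ p q t x y ≤ D * (1 / 2) ^ q := by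
    intro q
    induction q with
    | zero =>
      intro p h1 h2 t ht x hx y hy _
      have ht' : t ∈ Icc 0 T := ⟨ht.1.le, ht.2⟩
      have c1 := hΘbdd p ⟨h1, h2⟩ 0 t ht' x hx
      have c2 : ‖θl t y‖ ≤ M1 := hM1 (t, y) ⟨ht', hy⟩
      have c3 : ‖Θ p 0 t x - θl t y‖ ≤ |M₀| + |M1| :=
        (norm_sub_le _ _).trans (add_le_add (c1.trans (le_abs_self _)) (c2.trans (le_abs_self _)))
      have c4 := pow_le_pow_left₀ (norm_nonneg _) c3 2
      have c5 : 0 ≤ K * ‖x - y‖ ^ 2 := by positivity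
      have c6 : Real.exp (lm * t) ≤ Real.exp (lm * T) :=
        Real.exp_le_exp.2 (mul_le_mul_of_nonneg_left ht.2 hlm0)
      rw [pow_zero, mul_one]
      calc Φ p 0 t x y ≤ Real.exp (lm * t) * (|M₀| + |M1|) ^ 2 :=
            mul_le_mul_of_nonneg_left (by linarith) (Real.exp_pos _).le
        _ ≤ D := mul_le_mul_of_nonneg_right c6 (sq_nonneg _)
    | succ q ih =>
      intro p h1 h2 t ht x hx y hy hinn
      have hMq : 0 ≤ D * (1 / 2) ^ q := by positivity
      have := step q _ hMq ih p h1 h2 t ht x hx y hy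
      refine this.trans ?_
      have hfar : aa p + δ0 ≤ x (Fin.last n) ∧ x (Fin.last n) + δ0 ≤ bb p := by
        rcases hinn with ⟨hp, hxl⟩ | ⟨hp, hxl⟩
        · obtain ⟨k1, k2, k3, k4, k5⟩ := G.left h1 h2 hp
          rw [hxl]; constructor <;> linarith
        · obtain ⟨k1, k2, k3, k4, k5⟩ := G.right h1 h2 hp
          rw [hxl]; constructor <;> linarith
      have e1 : Real.exp (-κ * (x (Fin.last n) - aa p)) ≤ 1 / 4 :=
        (Real.exp_le_exp.2 (by nlinarith [hfar.1])).trans hκδ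
      have e2 : Real.exp (κ * (x (Fin.last n) - bb p)) ≤ 1 / 4 :=
        (Real.exp_le_exp.2 (by nlinarith [hfar.2])).trans hκδ
      calc _ ≤ D * (1 / 2) ^ q * (1 / 2) := mul_le_mul_of_nonneg_left (by linarith) hMq
        _ = _ := by ring
  refine ⟨2 * D, by positivity, ?_⟩
  intro q p h1 h2 t ht x hx
  have hMq : 0 ≤ D * (1 / 2) ^ q := by positivity
  have hxc : x ∈ closure (OpenCube (n := n) l) := (closure_cube hl x).2 (G.coord h1 h2 hx)
  have h3 := step q _ hMq (iter q) p h1 h2 t ht x hx x hxc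
  have hx2 := ((G.mem h1 h2 x).1 hx).2
  have e1 : Real.exp (-κ * (x (Fin.last n) - aa p)) ≤ 1 :=
    Real.exp_le_one_iff.2 (by nlinarith [hx2.1])
  have e2 : Real.exp (κ * (x (Fin.last n) - bb p)) ≤ 1 :=
    Real.exp_le_one_iff.2 (by nlinarith [hx2.2])
  have e3 : 1 ≤ Real.exp (lm * t) := Real.one_le_exp (mul_nonneg hlm0 ht.1.le)
  have e4 : ‖Θ p (q + 1) t x - θl t x‖ ^ 2 ≤ Φ p (q + 1) t x x := by
    simp only [hΦ, sub_self, norm_zero]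
    nlinarith [sq_nonneg ‖Θ p (q + 1) t x - θl t x‖]
  calc _ ≤ _ := e4
    _ ≤ _ := h3
    _ ≤ D * (1 / 2) ^ q * 2 := mul_le_mul_of_nonneg_left (by linarith) hMq
    _ = _ := by ring

/-- **Convergence of the Schwarz iteration (Theorem 3.2).**
Under assumptions (A1)–(A5), the Schwarz waveform-relaxation iterates `Θ p q`
converge, as `q → ∞`, to the solution `θl` of the decoupling PDE on `(0,T) × 𝒪_l`,
uniformly on the subdomains and uniformly in `p ∈ {1,…,I}`:
`lim_{q→∞} sup_p ‖Θ p q - θl‖_{L^∞((0,T) × Ω_p)} = 0`. -/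
theorem schwarz_iteration_converges {n m d : ℕ} {T l M₀ : ℝ} (hT : 0 < T)
    (I : ℕ) (aa bb : ℕ → ℝ)
    (hpart : SchwarzPartition I l aa bb)
    (b : ℝ → ES (n + 1) → ES m → ES (n + 1))
    (σ : ℝ → ES (n + 1) → ES m → Matrix (Fin (n + 1)) (Fin d) ℝ)
    (bh : ℝ → ES (n + 1) → ES m → ES m)
    (σh σinv : ℝ → ES (n + 1) → ES m → Matrix (Fin m) (Fin d) ℝ →
      Matrix (Fin m) (Fin d) ℝ)
    (g : ES (n + 1) → ES m) (κ lam η ν : ℝ → ℝ) (α δ C : ℝ)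
    (hA1 : AssumptionA1 b σ bh σh g δ)
    (hA2 : AssumptionA2 T σ ν C)
    (hA3 : AssumptionA3 T σh σinv κ lam α)
    (hA4 : AssumptionA4 T b bh η C)
    (hA5 : AssumptionA5 T bh)
    -- the initial guess `θ₀` is smooth and bounded; `M₀` bounds both `θ₀` and `g`
    (θ0 : ES (n + 1) → ES m) (hθ0smooth : ContDiff ℝ (⊤ : ℕ∞) θ0)
    (hθ0bdd : ∀ x, ‖θ0 x‖ ≤ M₀) (hgbdd : ∀ x, ‖g x‖ ≤ M₀)
    -- the Schwarz iterates and their uniform bound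
    (Θ : ℕ → ℕ → ℝ → ES (n + 1) → ES m)
    (hΘ : SchwarzIterates T l I aa bb (halfSigmaSigmaT σ) b bh g θ0 Θ)
    (hΘbdd : ∀ p ∈ Icc 1 I, ∀ q : ℕ, ∀ t ∈ Icc (0 : ℝ) T,
      ∀ x ∈ closure (Subdom l (aa p) (bb p)), ‖Θ p q t x‖ ≤ M₀)
    -- the solution on the whole cube `𝒪_l`
    (θl : ℝ → ES (n + 1) → ES m)
    (hθl : IsCubeSolution T l (halfSigmaSigmaT σ) b bh g θl) :
    ∀ ε > (0 : ℝ), ∃ N : ℕ, ∀ q ≥ N, ∀ p ∈ Icc 1 I,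
      ∀ t ∈ Ioo (0 : ℝ) T, ∀ x ∈ Subdom (n := n) l (aa p) (bb p),
        ‖Θ p q t x - θl t x‖ ≤ ε := by

  obtain ⟨δ0, G⟩ := geo_exists hpart
  obtain ⟨hb1, hbh1, hσ1, -, hgC1, -, hg2, Kg, hKg, -⟩ := hA1
  obtain ⟨hC0, hνc, hνpos, hσ2⟩ := hA2
  obtain ⟨hηpos, hb4, hbh4⟩ := hA4
  obtain ⟨Lb, hLb0, hLb⟩ := c1bdd_lip hb1
  obtain ⟨Lh, hLh0, hLh⟩ := c1bdd_lip hbh1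
  obtain ⟨Ls, hLs0, hLs⟩ := c1bdd_lip hσ1
  obtain ⟨Lg, hLg0, hLg⟩ := g_lip hgC1
  obtain ⟨L0, hL00, hL0⟩ := smooth_lip_cube (l := l) hθ0smooth
  have hM0 : 0 ≤ M₀ := (norm_nonneg _).trans (hgbdd 0)
  obtain ⟨ν0, hν0, hν0le⟩ : ∃ ν0 > 0, ∀ r ∈ Icc 0 M₀, ν0 ≤ ν r := by
    obtain ⟨r, hr, hmin⟩ := isCompact_Icc.exists_isMinOn (nonempty_Icc.2 hM0) hνc.continuousOn
    exact ⟨ν r, hνpos r, fun s hs => hmin hs⟩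
  have ellip : ∀ t ∈ Ioo 0 T, ∀ x w, ‖w‖ ≤ M₀ → ∀ i, ν0 ≤ ∑ c, σ t x w i c ^ 2 := by
    intro t ht x w hw i
    have h1 := (hσ2 t ⟨ht.1.le, ht.2.le⟩ x w).2.diag_nonneg (i := i)
    have h2 := hν0le ‖w‖ ⟨norm_nonneg _, hw⟩
    simp [Matrix.mul_apply] at h1
    simp only [sq]
    linarith
  have hent : ∀ (A : Matrix (Fin (n + 1)) (Fin d) ℝ) i c, |A i c| ≤ ‖A‖ := fun A i c =>
    Matrix.norm_entry_le_entrywise_sup_norm A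
  have bσ : ∀ t ∈ Ioo 0 T, ∀ x w i c, |σ t x w i c| ≤ C := fun t ht x w i c =>
    (hent _ i c).trans (hσ2 t ⟨ht.1.le, ht.2.le⟩ x w).1
  have bb' : ∀ t ∈ Ioo 0 T, ∀ x w, ‖w‖ ≤ M₀ → ‖b t x w‖ ≤ η 0 + Lb * M₀ := by
    intro t ht x w hw
    have h1 := hLb t t x x w 0
    have h2 := hb4 t ⟨ht.1.le, ht.2.le⟩ x 0
    simp only [sub_self, abs_zero, norm_zero, zero_add, sub_zero] at h1 h2
    have h3 := norm_add_le (b t x w - b t x 0) (b t x 0)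
    rw [sub_add_cancel] at h3
    have h4 := mul_le_mul_of_nonneg_left hw hLb0
    linarith
  have bbh : ∀ t ∈ Ioo 0 T, ∀ x w, ‖w‖ ≤ M₀ → ‖bh t x w‖ ≤ C + Lh * M₀ := by
    intro t ht x w hw
    have h1 := hLh t t x x w 0
    have h2 := hbh4 t ⟨ht.1.le, ht.2.le⟩ x
    simp only [sub_self, abs_zero, norm_zero, zero_add, sub_zero] at h1
    have h3 := norm_add_le (bh t x w - bh t x 0) (bh t x 0)
    rw [sub_add_cancel] at h3
    have h4 := mul_le_mul_of_nonneg_left hw hLh0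
    linarith
  have hB : 0 ≤ η 0 + Lb * M₀ := add_nonneg (hηpos 0).le (mul_nonneg hLb0 hM0)
  obtain ⟨CB, hCB, barr⟩ := barrier_all G hΘ hΘbdd hgbdd hg2 (fun x => (hKg x).2.1)
    (fun x => (hKg x).2.2) hLg hL0 hν0 hB ellip bσ bb' bbh
  have hsum : ∀ {L' s : ℝ}, L' ≤ Lb + Lh + Ls → 0 ≤ s → L' * s ≤ (Lb + Lh + Ls) * s :=
    fun h hs => mul_le_mul_of_nonneg_right h hs
  obtain ⟨D, hD, hfin⟩ := contraction G hΘ hΘbdd hθl (L := Lb + Lh + Ls) hLg0 hLg (by positivity)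
    hB hCB
    (fun t x y w w' => by
      have := hLh t t x y w w'
      rw [sub_self, abs_zero, zero_add] at this
      exact this.trans (hsum (by linarith) (by positivity)))
    (fun t x y w w' => by
      have := hLb t t x y w w'
      rw [sub_self, abs_zero, zero_add] at this
      exact this.trans (hsum (by linarith) (by positivity)))
    (fun t x y w w' i c => by
      have := hLs t t x y w w'
      rw [sub_self, abs_zero, zero_add] at this
      exact (hent (σ t x w - σ t y w') i c).trans
        (this.trans (hsum (by linarith) (by positivity))))
    bσ bb' barr
  intro ε hε
  obtain ⟨N, hN⟩ := exists_pow_lt_of_lt_one (show 0 < ε ^ 2 / (D + 1) by positivity)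
    (show (1 / 2 : ℝ) < 1 by norm_num)
  refine ⟨N + 1, fun q hq p hp t ht x hx => ?_⟩
  obtain ⟨r, rfl⟩ : ∃ r, q = r + 1 := ⟨q - 1, by omega⟩
  have h1 := hfin r p hp.1 hp.2 t ⟨ht.1, ht.2.le⟩ x (subset_closure hx)
  have h2 : (1 / 2 : ℝ) ^ r ≤ (1 / 2) ^ N :=
    pow_le_pow_of_le_one (by norm_num) (by norm_num) (by omega)
  have h3 : D * (1 / 2) ^ r ≤ ε ^ 2 := by
    have h4 : (D + 1) * (ε ^ 2 / (D + 1)) = ε ^ 2 := by field_simp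
    have h5 : (0 : ℝ) < (1 / 2) ^ r := by positivity
    nlinarith
  exact le_of_sq_le_sq (h1.trans h3) hε.le
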